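/- arXiv:1709.00869 — 5 statements merged into one kernel-verified Lean document; each statement's English description precedes it below -/
import Mathlib

section
/- Let P be a reversible, irreducible transition matrix on a finite state space with nonnegative spectrum, stationary distribution π, relaxation time t_rel = ⌈1/(1−λ₂)⌉, and inner product ⟨f,g⟩ = Σ_x π(x) f(x) g(x). Then for every real-valued function f on the state space, Σ_{s=0}^{∞} (s+1)·(⟨f, P^s f⟩ − ⟨f, 1⟩²) ≤ (t_rel/(1−1/e)²)·Σ_{s=0}^{t_rel−1} (⟨f, P^s f⟩ − ⟨f, 1⟩²). -/
open Finset
open scoped Classical BigOperators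

/-- The transition matrix of the lazy random walk on a finite graph `G`. -/
noncomputable def lazyP {V : Type} [Fintype V] (G : SimpleGraph V) : Matrix V V ℝ :=
  fun u v =>
    if u = v then 1 / 2
    else if G.Adj u v then 1 / (2 * (G.degree u : ℝ)) else 0

/-- The number of edges of `G`. -/
noncomputable def numEdges {V : Type} [Fintype V] (G : SimpleGraph V) : ℕ :=
  G.edgeFinset.card

/-- The stationary distribution `π(u) = deg(u) / (2m)` of the lazy random walk. -/
noncomputable def statDist {V : Type} [Fintype V] (G : SimpleGraph V) (u : V) : ℝ :=
  (G.degree u : ℝ) / (2 * (numEdges G : ℝ))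

/-- The second-largest eigenvalue `λ₂` of a reversible transition matrix: the supremum of
the (real) eigenvalues different from `1`. -/
noncomputable def secondEig {V : Type} [Fintype V] (P : Matrix V V ℝ) : ℝ :=
  sSup {r : ℝ | r ≠ 1 ∧ ∃ f : V → ℝ, f ≠ 0 ∧ P.mulVec f = r • f}

/-- The relaxation time `t_rel = ⌈1 / (1 - λ₂)⌉`. -/
noncomputable def relTime {V : Type} [Fintype V] (P : Matrix V V ℝ) : ℕ :=
  ⌈1 / (1 - secondEig P)⌉₊

/-- The uniform mixing time of the lazy random walk on `G`. -/
noncomputable def unifTime {V : Type} [Fintype V] (G : SimpleGraph V) : ℕ :=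
  sInf {t : ℕ | ∀ x y : V, |(lazyP G ^ t) x y / statDist G y - 1| ≤ 1 / 4}

/-- The Green's function `g_t(x, u) = ∑_{i<t} P^i(x, u)`. -/
noncomputable def green {V : Type} [Fintype V] (P : Matrix V V ℝ) (t : ℕ) (x u : V) : ℝ :=
  ∑ i ∈ Finset.range t, (P ^ i) x u

/-- The value of a finite trajectory at a natural number index (junk beyond the horizon). -/
noncomputable def traj {V : Type} [Nonempty V] {t : ℕ} (p : Fin t → V) (i : ℕ) : V :=
  if h : i < t then p ⟨i, h⟩ else Classical.arbitrary V

/-- The probability that the chain `P` started at `x` follows the length-`t` trajectory `p`. -/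
noncomputable def pathWeight {V : Type} [Fintype V] [Nonempty V] (P : Matrix V V ℝ)
    (x : V) (t : ℕ) (p : Fin t → V) : ℝ :=
  (if traj p 0 = x then 1 else 0) *
    ∏ i ∈ Finset.range (t - 1), P (traj p i) (traj p (i + 1))

/-- Expectation of a functional of two independent length-`t` walks started at `x` and `y`. -/
noncomputable def E2 {V : Type} [Fintype V] [Nonempty V] (P : Matrix V V ℝ) (x y : V)
    (t : ℕ) (F : (Fin t → V) → (Fin t → V) → ℝ) : ℝ :=
  ∑ p : Fin t → V, ∑ q : Fin t → V, pathWeight P x t p * pathWeight P y t q * F p q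

/-- Expectation of a functional of three independent length-`t` walks started at `x`. -/
noncomputable def E3 {V : Type} [Fintype V] [Nonempty V] (P : Matrix V V ℝ) (x : V)
    (t : ℕ) (F : (Fin t → V) → (Fin t → V) → (Fin t → V) → ℝ) : ℝ :=
  ∑ p : Fin t → V, ∑ q : Fin t → V, ∑ r : Fin t → V,
    pathWeight P x t p * pathWeight P x t q * pathWeight P x t r * F p q r

/-- Expectation of a functional of `2K` independent length-`t` walks
(`K` pairs) started at `x`. -/
noncomputable def EK {V : Type} [Fintype V] [Nonempty V] (P : Matrix V V ℝ) (x : V)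
    (t K : ℕ) (F : (Fin K → Fin t → V) → (Fin K → Fin t → V) → ℝ) : ℝ :=
  ∑ X : Fin K → Fin t → V, ∑ Y : Fin K → Fin t → V,
    (∏ k, pathWeight P x t (X k)) * (∏ k, pathWeight P x t (Y k)) * F X Y

/-- Expectation of a functional of `K` independent length-`t` walks started at `x`. -/
noncomputable def EKone {V : Type} [Fintype V] [Nonempty V] (P : Matrix V V ℝ) (x : V)
    (t K : ℕ) (F : (Fin K → Fin t → V) → ℝ) : ℝ :=
  ∑ X : Fin K → Fin t → V, (∏ k, pathWeight P x t (X k)) * F X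

/-- The weighted number of intersections of two trajectories over the time window `[a, b)`:
`∑_{i,j=a}^{b-1} (1 / deg(p_i)) 1{p_i = q_j}`. -/
noncomputable def wInterIco {V : Type} [Fintype V] [Nonempty V] (G : SimpleGraph V)
    (a b : ℕ) {t : ℕ} (p q : Fin t → V) : ℝ :=
  ∑ i ∈ Finset.Ico a b, ∑ j ∈ Finset.Ico a b,
    if traj p i = traj q j then 1 / (G.degree (traj p i) : ℝ) else 0

/-- The weighted number of intersections `𝓘_t` of two trajectories, up to time `t - 1`. -/
noncomputable def wInter {V : Type} [Fintype V] [Nonempty V] (G : SimpleGraph V)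
    {t : ℕ} (p q : Fin t → V) : ℝ :=
  wInterIco G 0 t p q

/-- The (unweighted) number of intersections `I_t` of two trajectories, up to time `t - 1`. -/
noncomputable def nInter {V : Type} [Nonempty V] {t : ℕ} (p q : Fin t → V) : ℝ :=
  ∑ i ∈ Finset.range t, ∑ j ∈ Finset.range t,
    if traj p i = traj q j then (1 : ℝ) else 0

/-- `E_{x,y}[𝓘_t]`: expected weighted number of intersections of two independent lazy random
walks started at `x` and `y`. -/
noncomputable def EIxy {V : Type} [Fintype V] [Nonempty V] (G : SimpleGraph V)
    (x y : V) (t : ℕ) : ℝ :=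
  E2 (lazyP G) x y t fun p q => wInter G p q

/-- `E_x[𝓘_t]`. -/
noncomputable def EI {V : Type} [Fintype V] [Nonempty V] (G : SimpleGraph V)
    (x : V) (t : ℕ) : ℝ :=
  EIxy G x x t

/-- `E_x[𝓘_t²]`. -/
noncomputable def EIsq {V : Type} [Fintype V] [Nonempty V] (G : SimpleGraph V)
    (x : V) (t : ℕ) : ℝ :=
  E2 (lazyP G) x x t fun p q => (wInter G p q) ^ 2

/-- `E_x[𝓙_t]`: expected weighted number of intersections over the window
`[t_unif, t_unif + t - 1]`. -/
noncomputable def EJ {V : Type} [Fintype V] [Nonempty V] (G : SimpleGraph V)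
    (x : V) (t : ℕ) : ℝ :=
  E2 (lazyP G) x x (unifTime G + t) fun p q =>
    wInterIco G (unifTime G) (unifTime G + t) p q

/-- `E_x[𝓙_t²]`. -/
noncomputable def EJsq {V : Type} [Fintype V] [Nonempty V] (G : SimpleGraph V)
    (x : V) (t : ℕ) : ℝ :=
  E2 (lazyP G) x x (unifTime G + t) fun p q =>
    (wInterIco G (unifTime G) (unifTime G + t) p q) ^ 2

/-- `E_x[ℒ_t]`: expected weighted number of intersections between times `t` and `2t - 1`. -/
noncomputable def EL {V : Type} [Fintype V] [Nonempty V] (G : SimpleGraph V)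
    (x : V) (t : ℕ) : ℝ :=
  E2 (lazyP G) x x (2 * t) fun p q => wInterIco G t (2 * t) p q

/-- `E_x[ℒ_t²]`. -/
noncomputable def ELsq {V : Type} [Fintype V] [Nonempty V] (G : SimpleGraph V)
    (x : V) (t : ℕ) : ℝ :=
  E2 (lazyP G) x x (2 * t) fun p q => (wInterIco G t (2 * t) p q) ^ 2

/-- `E_x[ℒ_t^{(X,Y)} · ℒ_t^{(X,Z)}]` for three independent walks `X, Y, Z` started at `x`. -/
noncomputable def ELprod {V : Type} [Fintype V] [Nonempty V] (G : SimpleGraph V)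
    (x : V) (t : ℕ) : ℝ :=
  E3 (lazyP G) x (2 * t) fun p q r =>
    wInterIco G t (2 * t) p q * wInterIco G t (2 * t) p r

/-- The inner product `⟨f, g⟩_π = ∑_x π(x) f(x) g(x)`. -/
noncomputable def ipi {X : Type} [Fintype X] (π : X → ℝ) (f g : X → ℝ) : ℝ :=
  ∑ x, π x * f x * g x

/-- The position of the first occurrence of `s i` in the finite sequence `s`. -/
noncomputable def firstOcc {V : Type} {N : ℕ} (s : Fin N → V) (i : Fin N) : ℕ :=
  sInf {j : ℕ | ∃ h : j < N, s ⟨j, h⟩ = s i}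

/-- The index (rank) of first occurrence of `s i` among the distinct values of `s`,
in order of first appearance. -/
noncomputable def rankSeq {V : Type} {N : ℕ} (s : Fin N → V) (i : Fin N) : ℕ :=
  ((Finset.univ.image fun j : Fin N => firstOcc s j).filter
    fun a => a ≤ firstOcc s i).card

/-- The profile `Φ` of a finite sequence of vertices: the sequence of ranks of first
occurrence together with the sequence of degrees. -/
noncomputable def profileOf {V : Type} [Fintype V] (G : SimpleGraph V) {N : ℕ}
    (s : Fin N → V) : Fin N → ℕ × ℕ :=
  fun i => (rankSeq s i, G.degree (s i))

/-- Concatenation of `K` trajectories of length `t` into one sequence of length `K * t`. -/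
noncomputable def concatW {V : Type} [Nonempty V] {K t : ℕ} (X : Fin K → Fin t → V)
    (i : Fin (K * t)) : V :=
  if h : 0 < t then
    X ⟨i.1 / t, (Nat.div_lt_iff_lt_mul h).2 i.2⟩ ⟨i.1 % t, Nat.mod_lt _ h⟩
  else Classical.arbitrary V

lemma aux_ipi_add {X : Type} [Fintype X] (π f g h : X → ℝ) :
    ipi π f (g + h) = ipi π f g + ipi π f h := by
  simp only [ipi, Pi.add_apply, mul_add, Finset.sum_add_distrib]

lemma aux_ipi_smul {X : Type} [Fintype X] (π f g : X → ℝ) (c : ℝ) :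
    ipi π f (c • g) = c * ipi π f g := by
  simp only [ipi, Pi.smul_apply, smul_eq_mul, Finset.mul_sum]
  exact Finset.sum_congr rfl fun x _ => by ring

lemma aux_ipi_comm {X : Type} [Fintype X] (π f g : X → ℝ) :
    ipi π f g = ipi π g f := by
  simp only [ipi]
  exact Finset.sum_congr rfl fun x _ => by ring

lemma aux_selfadj {X : Type} [Fintype X] (P : Matrix X X ℝ) (π : X → ℝ)
    (hrev : ∀ x y, π x * P x y = π y * P y x) (f g : X → ℝ) :
    ipi π f (P.mulVec g) = ipi π (P.mulVec f) g := by
  simp only [ipi, Matrix.mulVec, dotProduct, Finset.mul_sum, Finset.sum_mul]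
  rw [Finset.sum_comm]
  refine Finset.sum_congr rfl fun x _ => Finset.sum_congr rfl fun y _ => ?_
  have := hrev x y
  linear_combination (-(f y * g x)) * this

lemma aux_basis {X : Type} [Fintype X] (P : Matrix X X ℝ) (π : X → ℝ)
    (hπpos : ∀ x, 0 < π x) (hrev : ∀ x y, π x * P x y = π y * P y x) :
    ∃ (φ : X → X → ℝ) (l : X → ℝ), (∀ i, φ i ≠ 0) ∧ (∀ i, P.mulVec (φ i) = l i • φ i) ∧
      ∀ f g : X → ℝ, ipi π f g = ∑ i, ipi π f (φ i) * ipi π g (φ i) := by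
  have hs : ∀ x, 0 < √(π x) := fun x => Real.sqrt_pos.2 (hπpos x)
  have hss : ∀ x, √(π x) * √(π x) = π x := fun x => Real.mul_self_sqrt (hπpos x).le
  let A : Matrix X X ℝ := fun x y => √(π x) * P x y / √(π y)
  have hA : A.IsHermitian := by
    ext x y
    rw [Matrix.conjTranspose_apply, star_trivial]
    change √(π y) * P y x / √(π x) = √(π x) * P x y / √(π y)
    rw [div_eq_div_iff (hs x).ne' (hs y).ne']
    have := hrev x y
    rw [← hss x, ← hss y] at this
    linear_combination -this
  let b := hA.eigenvectorBasis
  have hφ : ∀ (f : X → ℝ) i, ipi π f (fun x => b i x / √(π x)) =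
      inner ℝ (WithLp.toLp 2 (fun x => √(π x) * f x) : EuclideanSpace ℝ X) (b i) := by
    intro f i
    simp only [ipi, PiLp.inner_apply, RCLike.inner_apply, conj_trivial]
    refine Finset.sum_congr rfl fun x _ => ?_
    have := (hs x).ne'
    field_simp
    rw [Real.sq_sqrt (hπpos x).le]
    ring
  refine ⟨fun i x => b i x / √(π x), hA.eigenvalues, ?_, ?_, ?_⟩
  · intro i h
    have h1 : b i = 0 := by
      ext x
      have := congrFun h x
      simpa [(hs x).ne'] using this
    have := b.orthonormal.1 i
    rw [h1] at this
    simp at this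
  · intro i
    have h := hA.mulVec_eigenvectorBasis i
    ext x
    have hx := congrFun h x
    simp only [Matrix.mulVec, dotProduct, A, Pi.smul_apply, smul_eq_mul] at hx ⊢
    have : ∑ y, √(π x) * P x y / √(π y) * b i y = √(π x) * ∑ y, P x y * (b i y / √(π y)) := by
      rw [Finset.mul_sum]
      exact Finset.sum_congr rfl fun y _ => by ring
    have hx2 : √(π x) * ∑ y, P x y * (b i y / √(π y)) = hA.eigenvalues i * b i x := by
      rw [← this]; exact hx
    rw [mul_div_assoc', eq_div_iff (hs x).ne', ← hx2]; ring
  · intro f g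
    simp only [hφ]
    have := b.sum_inner_mul_inner (WithLp.toLp 2 (fun x => √(π x) * f x) : EuclideanSpace ℝ X)
      (WithLp.toLp 2 (fun x => √(π x) * g x) : EuclideanSpace ℝ X)
    have h2 : ipi π f g = inner ℝ (WithLp.toLp 2 (fun x => √(π x) * f x) : EuclideanSpace ℝ X)
      (WithLp.toLp 2 (fun x => √(π x) * g x) : EuclideanSpace ℝ X) := by
      simp only [ipi, PiLp.inner_apply, RCLike.inner_apply, conj_trivial]
      exact Finset.sum_congr rfl fun x _ => by linear_combination (-(f x * g x)) * hss x
    rw [h2, ← this]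
    exact Finset.sum_congr rfl fun i _ => by rw [real_inner_comm _ (b i)]

lemma aux_eig_le_one {X : Type} [Fintype X] [Nonempty X] (P : Matrix X X ℝ)
    (hPnonneg : ∀ x y, 0 ≤ P x y) (hPstoch : ∀ x, ∑ y, P x y = 1)
    (r : ℝ) (h : X → ℝ) (h0 : h ≠ 0) (he : P.mulVec h = r • h) : r ≤ 1 := by
  obtain ⟨x, hx⟩ := Finite.exists_max (fun x => |h x|)
  have hpos : 0 < |h x| := by
    obtain ⟨y, hy⟩ := Function.ne_iff.1 h0
    exact lt_of_lt_of_le (abs_pos.2 hy) (hx y)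
  have h1 := congrFun he x
  simp only [Matrix.mulVec, dotProduct, Pi.smul_apply, smul_eq_mul] at h1
  have h2 : |r| * |h x| ≤ |h x| := by
    rw [← abs_mul, ← h1]
    calc _ ≤ ∑ y, |P x y * h y| := Finset.abs_sum_le_sum_abs _ _
      _ ≤ ∑ y, P x y * |h x| := Finset.sum_le_sum fun y _ => by
          rw [abs_mul, abs_of_nonneg (hPnonneg x y)]
          exact mul_le_mul_of_nonneg_left (hx y) (hPnonneg x y)
      _ = |h x| := by rw [← Finset.sum_mul, hPstoch, one_mul]
  have := le_abs_self r
  nlinarith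

lemma aux_pow_eig {X : Type} [Fintype X] (P : Matrix X X ℝ) (h : X → ℝ)
    (he : P.mulVec h = h) (n : ℕ) : (P ^ n).mulVec h = h := by
  induction n with
  | zero => simp
  | succ n ih => rw [pow_succ, ← Matrix.mulVec_mulVec, he, ih]

lemma aux_pow_nonneg {X : Type} [Fintype X] (P : Matrix X X ℝ)
    (hPnonneg : ∀ x y, 0 ≤ P x y) (n : ℕ) : ∀ x y, 0 ≤ (P ^ n) x y := by
  induction n with
  | zero => intro x y; rw [pow_zero, Matrix.one_apply]; split_ifs <;> norm_num
  | succ n ih =>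
    intro x y
    rw [pow_succ, Matrix.mul_apply]
    exact Finset.sum_nonneg fun z _ => mul_nonneg (ih x z) (hPnonneg z y)

lemma aux_one {X : Type} [Fintype X] (P : Matrix X X ℝ)
    (hPstoch : ∀ x, ∑ y, P x y = 1) : P.mulVec (1 : X → ℝ) = 1 := by
  ext x
  simp [Matrix.mulVec, dotProduct, hPstoch]

lemma aux_harm {X : Type} [Fintype X] [Nonempty X] (P : Matrix X X ℝ)
    (hPnonneg : ∀ x y, 0 ≤ P x y) (hPstoch : ∀ x, ∑ y, P x y = 1)
    (hirr : ∀ x y, ∃ n : ℕ, 0 < (P ^ n) x y)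
    (h : X → ℝ) (he : P.mulVec h = h) : ∃ c : ℝ, h = c • (1 : X → ℝ) := by
  obtain ⟨x, hx⟩ := Finite.exists_max h
  refine ⟨h x, ?_⟩
  ext y
  simp only [Pi.smul_apply, Pi.one_apply, smul_eq_mul, mul_one]
  obtain ⟨n, hn⟩ := hirr x y
  have h1 := congrFun (aux_pow_eig P h he n) x
  have h2 := congrFun (aux_pow_eig P 1 (aux_one P hPstoch) n) x
  simp only [Matrix.mulVec, dotProduct, Pi.one_apply, mul_one] at h1 h2
  have h3 : ∑ z, (P ^ n) x z * (h x - h z) = 0 := by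
    simp only [mul_sub, Finset.sum_sub_distrib, ← Finset.sum_mul]
    rw [h1, h2]; ring
  have h4 := (Finset.sum_eq_zero_iff_of_nonneg (fun z _ =>
    mul_nonneg (aux_pow_nonneg P hPnonneg n x z) (sub_nonneg.2 (hx z)))).1 h3 y (Finset.mem_univ y)
  have h5 := (mul_eq_zero.1 h4).resolve_left hn.ne'
  linarith

lemma aux_rel {X : Type} [Fintype X] [Nonempty X] (P : Matrix X X ℝ)
    (hPnonneg : ∀ x y, 0 ≤ P x y) (hPstoch : ∀ x, ∑ y, P x y = 1)
    (r : ℝ) (h : X → ℝ) (h0 : h ≠ 0) (he : P.mulVec h = r • h) (hr : r ≠ 1) :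
    1 ≤ (relTime P : ℝ) * (1 - r) := by
  set S := {r : ℝ | r ≠ 1 ∧ ∃ f : X → ℝ, f ≠ 0 ∧ P.mulVec f = r • f} with hS
  have hmem : r ∈ S := ⟨hr, h, h0, he⟩
  have hfin : S.Finite := by
    refine (Module.End.finite_hasEigenvalue (Matrix.toLin' P)).subset ?_
    rintro a ⟨-, f, hf, hfe⟩
    exact Module.End.hasEigenvalue_of_hasEigenvector
      (Module.End.hasEigenvector_iff.2 ⟨Module.End.mem_eigenspace_iff.2 (by simpa using hfe), hf⟩)
  have h1 : r ≤ secondEig P := le_csSup hfin.bddAbove hmem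
  have h2 : secondEig P ∈ S := Set.Nonempty.csSup_mem ⟨r, hmem⟩ hfin
  obtain ⟨h3, f, hf, hfe⟩ := h2
  have h4 : secondEig P < 1 :=
    lt_of_le_of_ne (aux_eig_le_one P hPnonneg hPstoch _ f hf hfe) h3
  have h5 : 1 / (1 - secondEig P) ≤ (relTime P : ℝ) := Nat.le_ceil _
  rw [div_le_iff₀ (by linarith)] at h5
  have : (0:ℝ) ≤ relTime P := Nat.cast_nonneg _
  nlinarith

lemma aux_hasSum (r : ℝ) (h0 : 0 ≤ r) (h1 : r < 1) :
    HasSum (fun s : ℕ => ((s : ℝ) + 1) * r ^ s) (1 / (1 - r) ^ 2) := by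
  have := hasSum_choose_mul_geometric_of_norm_lt_one (𝕜 := ℝ) 1 (r := r)
    (by rwa [Real.norm_eq_abs, abs_of_nonneg h0])
  simpa using this

lemma aux_scalar (r : ℝ) (h0 : 0 ≤ r) (h1 : r < 1) (t : ℕ) (ht : 1 ≤ (t : ℝ) * (1 - r)) :
    1 / (1 - r) ^ 2 ≤ ((t : ℝ) / (1 - 1 / Real.exp 1) ^ 2) * ∑ s ∈ Finset.range t, r ^ s := by
  have he : 1 / Real.exp 1 < 1 := by
    rw [div_lt_one (Real.exp_pos 1)]; exact Real.one_lt_exp_iff.2 one_pos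
  have he0 : 0 < 1 / Real.exp 1 := by positivity
  have hrt : r ^ t ≤ 1 / Real.exp 1 := by
    have ha : r ≤ Real.exp (-(1 - r)) := by
      have := Real.add_one_le_exp (-(1 - r)); linarith
    calc r ^ t ≤ (Real.exp (-(1 - r))) ^ t := pow_le_pow_left₀ h0 ha t
      _ = Real.exp (t * (-(1 - r))) := (Real.exp_nat_mul _ _).symm
      _ ≤ Real.exp (-1) := Real.exp_le_exp.2 (by linarith)
      _ = 1 / Real.exp 1 := by rw [Real.exp_neg, one_div]
  set a := 1 / Real.exp 1
  have hg : (∑ s ∈ Finset.range t, r ^ s) * (1 - r) = 1 - r ^ t := geom_sum_mul_neg r t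
  set G := ∑ s ∈ Finset.range t, r ^ s
  have hr : 0 < 1 - r := by linarith
  have ha : 0 < 1 - a := by linarith
  rw [div_mul_eq_mul_div, div_le_div_iff₀ (by positivity) (by positivity), one_mul]
  have : (t : ℝ) * G * (1 - r) ^ 2 = (t * (1 - r)) * (1 - r ^ t) := by rw [← hg]; ring
  rw [this]
  nlinarith

/-- Let `P` be a reversible, irreducible transition matrix on a finite
state space with nonnegative spectrum, stationary distribution `π` and relaxation time
`t_rel = ⌈1/(1-λ₂)⌉`. Then for every `f`:
`∑_{s=0}^∞ (s+1)(⟨f, P^s f⟩ - ⟨f, 1⟩²) ≤ (t_rel/(1 - 1/e)²) ∑_{s<t_rel} (⟨f, P^s f⟩ - ⟨f, 1⟩²)`. -/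
theorem sum_weighted_correlations_bound {X : Type} [Fintype X] [Nonempty X]
    (P : Matrix X X ℝ) (π : X → ℝ)
    (hπpos : ∀ x, 0 < π x) (hπsum : ∑ x, π x = 1)
    (hPnonneg : ∀ x y, 0 ≤ P x y) (hPstoch : ∀ x, ∑ y, P x y = 1)
    (hπstat : ∀ y, ∑ x, π x * P x y = π y)
    (hrev : ∀ x y, π x * P x y = π y * P y x)
    (hirr : ∀ x y, ∃ n : ℕ, 0 < (P ^ n) x y)
    (hspec : ∀ (r : ℝ) (f : X → ℝ), f ≠ 0 → P.mulVec f = r • f → 0 ≤ r)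
    (f : X → ℝ) :
    ∑' s : ℕ, ((s : ℝ) + 1) * (ipi π f ((P ^ s).mulVec f) - (ipi π f 1) ^ 2) ≤
      ((relTime P : ℝ) / (1 - 1 / Real.exp 1) ^ 2) *
        ∑ s ∈ Finset.range (relTime P),
          (ipi π f ((P ^ s).mulVec f) - (ipi π f 1) ^ 2) := by
  obtain ⟨φ, l, hφ0, hφe, hpars⟩ := aux_basis P π hπpos hrev
  set m := ipi π f 1 with hm
  set g : X → ℝ := f + (-m) • (1 : X → ℝ) with hg
  have h11 : ipi π (1 : X → ℝ) 1 = 1 := by simpa [ipi] using hπsum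
  have hg1 : ipi π g 1 = 0 := by
    rw [aux_ipi_comm, hg, aux_ipi_add, aux_ipi_smul, h11, aux_ipi_comm, ← hm]; ring
  have hone := fun s => aux_pow_eig P 1 (aux_one P hPstoch) s
  have hstat : ∀ s, ipi π (1 : X → ℝ) ((P ^ s).mulVec f) = m := by
    intro s
    induction s with
    | zero => rw [pow_zero, Matrix.one_mulVec, aux_ipi_comm]
    | succ s ih =>
      rw [pow_succ', ← Matrix.mulVec_mulVec, aux_selfadj P π hrev, aux_one P hPstoch, ih]
  have hW : ∀ s : ℕ, ipi π f ((P ^ s).mulVec f) - m ^ 2 = ipi π g ((P ^ s).mulVec g) := by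
    intro s
    have h1 : (P ^ s).mulVec g = (P ^ s).mulVec f + (-m) • (1 : X → ℝ) := by
      rw [hg, Matrix.mulVec_add, Matrix.mulVec_smul, hone]
    rw [h1, aux_ipi_add, aux_ipi_smul, hg1, aux_ipi_comm π g, hg, aux_ipi_add, aux_ipi_smul,
      aux_ipi_comm π _ 1, hstat, aux_ipi_comm π _ f]
    ring
  have hpow : ∀ (s : ℕ) i, ipi π ((P ^ s).mulVec g) (φ i) = l i ^ s * ipi π g (φ i) := by
    intro s i
    induction s with
    | zero => simp
    | succ s ih =>
      rw [pow_succ', ← Matrix.mulVec_mulVec, ← aux_selfadj P π hrev, hφe, aux_ipi_smul, ih]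
      ring
  have hW2 : ∀ s : ℕ, ipi π f ((P ^ s).mulVec f) - m ^ 2 =
      ∑ i, ipi π g (φ i) ^ 2 * l i ^ s := by
    intro s
    rw [hW, hpars]
    exact Finset.sum_congr rfl fun i _ => by rw [hpow]; ring
  have hl0 : ∀ i, 0 ≤ l i := fun i => hspec _ _ (hφ0 i) (hφe i)
  have hl1 : ∀ i, l i ≤ 1 := fun i => aux_eig_le_one P hPnonneg hPstoch _ _ (hφ0 i) (hφe i)
  have hc : ∀ i, l i = 1 → ipi π g (φ i) = 0 := by
    intro i hi
    obtain ⟨c, hc⟩ := aux_harm P hPnonneg hPstoch hirr (φ i) (by rw [hφe, hi, one_smul])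
    rw [hc, aux_ipi_smul, hg1, mul_zero]
  have hsum : ∀ i, HasSum (fun s : ℕ => ((s : ℝ) + 1) * (ipi π g (φ i) ^ 2 * l i ^ s))
      (ipi π g (φ i) ^ 2 * (1 / (1 - l i) ^ 2)) := by
    intro i
    by_cases hi : l i = 1
    · simp [hc i hi, hasSum_zero]
    · have := (aux_hasSum (l i) (hl0 i) (lt_of_le_of_ne (hl1 i) hi)).mul_left (ipi π g (φ i) ^ 2)
      refine this.congr_fun ?_ |> id
      intro s
      ring
  have htot := hasSum_sum (s := Finset.univ) (fun i _ => hsum i)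
  simp only [hW2, Finset.mul_sum]
  rw [htot.tsum_eq, Finset.sum_comm]
  refine Finset.sum_le_sum fun i _ => ?_
  by_cases hi : l i = 1
  · simp [hc i hi]
  · have := aux_scalar (l i) (hl0 i) (lt_of_le_of_ne (hl1 i) hi) (relTime P)
      (aux_rel P hPnonneg hPstoch _ _ (hφ0 i) (hφe i) hi)
    refine (mul_le_mul_of_nonneg_left this (sq_nonneg (ipi π g (φ i)))).trans_eq ?_
    rw [Finset.mul_sum, Finset.mul_sum]
    exact Finset.sum_congr rfl fun s _ => by ring
end

section
/- For every finite connected graph G=(V,E) with n vertices, m edges and minimum degree d, the relaxation time of the lazy random walk satisfies t_rel ≤ 12·m·n/d. -/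
open Finset
open scoped Classical BigOperators

section helpers
variable {V : Type} [Fintype V]

theorem aux_deg (G : SimpleGraph V) (x : V) :
    (G.degree x : ℝ) = ∑ y, if G.Adj x y then (1:ℝ) else 0 := by
  rw [Finset.sum_boole, ← SimpleGraph.card_neighborFinset_eq_degree, SimpleGraph.neighborFinset_eq_filter]

theorem aux_mul (G : SimpleGraph V) (x : V) (hx : 0 < G.degree x) (f : V → ℝ) :
    (G.degree x : ℝ) * (lazyP G).mulVec f x =
      (G.degree x : ℝ) * f x / 2 + (∑ y, if G.Adj x y then f y else 0) / 2 := by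
  have hx' : (G.degree x : ℝ) ≠ 0 := by positivity
  have h : (lazyP G).mulVec f x =
      ∑ y, ((if x = y then f y / 2 else 0) +
        (if G.Adj x y then f y else 0) / (2 * (G.degree x : ℝ))) := by
    unfold Matrix.mulVec dotProduct lazyP
    refine Finset.sum_congr rfl fun y _ => ?_
    by_cases h1 : x = y
    · subst h1; simp; ring
    · by_cases h2 : G.Adj x y <;> simp [h1, h2]; ring
  rw [h, Finset.sum_add_distrib, ← Finset.sum_div]
  simp only [Finset.sum_ite_eq, Finset.mem_univ, if_true]
  field_simp

theorem aux_energy (G : SimpleGraph V) (hd : ∀ x, 0 < G.degree x) (f : V → ℝ) (r : ℝ)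
    (hf : (lazyP G).mulVec f = r • f) :
    (∑ x, ∑ y, if G.Adj x y then (f x - f y) ^ 2 else 0) =
      4 * (1 - r) * ∑ x, (G.degree x : ℝ) * f x ^ 2 := by
  have e1 : ∀ x, (∑ y, if G.Adj x y then f y else 0) = (2 * r - 1) * (G.degree x * f x) := by
    intro x
    have := aux_mul G x (hd x) f
    rw [hf] at this
    simp only [Pi.smul_apply, smul_eq_mul] at this
    linarith
  have e2 : (∑ x, ∑ y, if G.Adj x y then f x * f y else 0)
      = (2 * r - 1) * ∑ x, (G.degree x : ℝ) * f x ^ 2 := by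
    rw [Finset.mul_sum]
    refine Finset.sum_congr rfl fun x _ => ?_
    have : (∑ y, if G.Adj x y then f x * f y else 0) = f x * ∑ y, if G.Adj x y then f y else 0 := by
      rw [Finset.mul_sum]; simp
    rw [this, e1]; ring
  have e3 : (∑ x, ∑ y, if G.Adj x y then f x ^ 2 else 0) = ∑ x, (G.degree x : ℝ) * f x ^ 2 := by
    refine Finset.sum_congr rfl fun x _ => ?_
    rw [aux_deg, Finset.sum_mul]; simp
  have e4 : (∑ x, ∑ y, if G.Adj x y then f y ^ 2 else 0) = ∑ x, (G.degree x : ℝ) * f x ^ 2 := by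
    rw [Finset.sum_comm, ← e3]
    simp only [G.adj_comm]
  have e5 : (∑ x, ∑ y, if G.Adj x y then (f x - f y) ^ 2 else 0) =
      (∑ x, ∑ y, if G.Adj x y then f x ^ 2 else 0) + (∑ x, ∑ y, if G.Adj x y then f y ^ 2 else 0)
       - 2 * (∑ x, ∑ y, if G.Adj x y then f x * f y else 0) := by
    simp only [Finset.mul_sum, ← Finset.sum_add_distrib, ← Finset.sum_sub_distrib]
    refine Finset.sum_congr rfl fun x _ => Finset.sum_congr rfl fun y _ => ?_
    split_ifs <;> ring
  rw [e5, e2, e3, e4]; ring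

theorem aux_zero (G : SimpleGraph V) (hd : ∀ x, 0 < G.degree x) (f : V → ℝ) (r : ℝ) (hr : r ≠ 1)
    (hf : (lazyP G).mulVec f = r • f) : ∑ x, (G.degree x : ℝ) * f x = 0 := by
  have e1 : ∀ x, (∑ y, if G.Adj x y then f y else 0) = (2 * r - 1) * (G.degree x * f x) := by
    intro x
    have := aux_mul G x (hd x) f
    rw [hf] at this
    simp only [Pi.smul_apply, smul_eq_mul] at this
    linarith
  have e2 : (∑ x, ∑ y, if G.Adj x y then f y else 0) = ∑ x, (G.degree x : ℝ) * f x := by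
    rw [Finset.sum_comm]
    refine Finset.sum_congr rfl fun x _ => ?_
    rw [aux_deg, Finset.sum_mul]; simp [G.adj_comm]
  simp only [e1, ← Finset.mul_sum] at e2
  have h3 : (r - 1) * ∑ x, (G.degree x : ℝ) * f x = 0 := by linarith
  exact (mul_eq_zero.1 h3).resolve_left (sub_ne_zero.2 hr)

theorem aux_path (G : SimpleGraph V) (hG : G.Connected) (u v : V) :
    ∃ (L : ℕ) (p : ℕ → V), p 0 = u ∧ p L = v ∧ (∀ i < L, G.Adj (p i) (p (i+1))) ∧
      ∀ i ≤ L, G.dist u (p i) = i := by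
  obtain ⟨w, hw⟩ := hG.exists_walk_length_eq_dist u v
  refine ⟨w.length, w.getVert, by simp, by simp, fun i hi => w.adj_getVert_succ hi, fun i hi => ?_⟩
  have h1 := SimpleGraph.dist_le (w.take i)
  have h2 := SimpleGraph.dist_le (w.drop i)
  have h3 := hG.dist_triangle (u := u) (v := w.getVert i) (w := v)
  simp only [SimpleGraph.Walk.take_length, SimpleGraph.Walk.drop_length] at h1 h2
  omega

theorem aux_len (G : SimpleGraph V) (hG : G.Connected) (u : V) (L : ℕ) (p : ℕ → V)
    (hp : ∀ i ≤ L, G.dist u (p i) = i) : L * G.minDegree ≤ 3 * Fintype.card V := by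
  have h1 : ∑ i ∈ Finset.range L, G.degree (p i) ≤ 3 * Fintype.card V := by
    have : ∀ x, G.degree x = ∑ y, if G.Adj x y then 1 else 0 := by
      intro x
      rw [Finset.sum_boole, ← SimpleGraph.card_neighborFinset_eq_degree,
        SimpleGraph.neighborFinset_eq_filter]; simp
    simp only [this]
    rw [Finset.sum_comm]
    have : ∀ y ∈ (Finset.univ : Finset V),
        (∑ i ∈ Finset.range L, if G.Adj (p i) y then 1 else 0) ≤ 3 := by
      intro y _
      rw [Finset.sum_boole]
      have hs : (Finset.range L).filter (fun i => G.Adj (p i) y) ⊆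
          Finset.Icc (G.dist u y - 1) (G.dist u y + 1) := by
        intro i hi
        simp only [Finset.mem_filter, Finset.mem_range, Finset.mem_Icc] at hi ⊢
        have a := hp i hi.1.le
        have b := hG.dist_triangle (u := u) (v := p i) (w := y)
        have c := hG.dist_triangle (u := u) (v := y) (w := p i)
        have d1 := SimpleGraph.dist_eq_one_iff_adj.2 hi.2
        have d2 := SimpleGraph.dist_eq_one_iff_adj.2 hi.2.symm
        omega
      have := Finset.card_le_card hs
      simp only [Nat.card_Icc] at this
      simp only [Nat.cast_id]
      omega
    refine (Finset.sum_le_sum this).trans ?_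
    simp [mul_comm]
  have h2 : L * G.minDegree ≤ ∑ i ∈ Finset.range L, G.degree (p i) := by
    have := Finset.card_nsmul_le_sum (Finset.range L) (fun i => G.degree (p i)) G.minDegree
      (fun i _ => G.minDegree_le_degree _)
    simpa using this
  exact h2.trans h1

theorem aux_cs (G : SimpleGraph V) (u : V) (L : ℕ) (p : ℕ → V)
    (ha : ∀ i < L, G.Adj (p i) (p (i+1)))
    (hp : ∀ i ≤ L, G.dist u (p i) = i) (f : V → ℝ) :
    (f (p L) - f (p 0)) ^ 2 ≤ L * ∑ x, ∑ y, if G.Adj x y then (f x - f y) ^ 2 else 0 := by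
  rw [← Finset.sum_range_sub (fun i => f (p i)) L]
  refine (sq_sum_le_card_mul_sum_sq).trans ?_
  rw [Finset.card_range]
  refine mul_le_mul_of_nonneg_left ?_ (by positivity)
  rw [← Finset.sum_product']
  have hinj : Set.InjOn (fun i => (p i, p (i+1))) (Finset.range L : Set ℕ) := by
    intro i hi j hj h
    simp only [Finset.coe_range, Set.mem_Iio] at hi hj
    have : p i = p j := congrArg Prod.fst h
    rw [← hp i hi.le, ← hp j hj.le, this]
  calc _ = ∑ i ∈ Finset.range L, (fun q : V × V => if G.Adj q.1 q.2 then (f q.1 - f q.2) ^ 2 else 0)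
          (p i, p (i+1)) := by
        refine Finset.sum_congr rfl fun i hi => ?_
        simp only [ha i (Finset.mem_range.1 hi), if_true]; ring
    _ = ∑ q ∈ (Finset.range L).image (fun i => (p i, p (i+1))),
          (if G.Adj q.1 q.2 then (f q.1 - f q.2) ^ 2 else 0) := by
        rw [Finset.sum_image hinj]
    _ ≤ _ := by
        refine Finset.sum_le_sum_of_subset_of_nonneg ?_ ?_
        · intro q _; simp
        · intro q _ _; split_ifs <;> positivity

theorem aux_gap [Nontrivial V] (G : SimpleGraph V) (hG : G.Connected) (hd : ∀ x, 0 < G.degree x)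
    (f : V → ℝ) (hf0 : f ≠ 0) (r : ℝ) (hr : r ≠ 1)
    (hf : (lazyP G).mulVec f = r • f) :
    ∃ L : ℕ, L * G.minDegree ≤ 3 * Fintype.card V ∧
      1 ≤ 2 * (numEdges G : ℝ) * L * (1 - r) := by
  obtain ⟨u, hu⟩ := Finite.exists_min f
  obtain ⟨v, hv⟩ := Finite.exists_max f
  obtain ⟨L, p, hp0, hpL, ha, hp⟩ := aux_path G hG u v
  refine ⟨L, aux_len G hG u L p hp, ?_⟩
  have hcs := aux_cs G u L p ha hp f
  rw [aux_energy G hd f r hf, hp0, hpL] at hcs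
  have hz := aux_zero G hd f r hr hf
  have hdeg : ∑ x, (G.degree x : ℝ) = 2 * numEdges G := by
    unfold numEdges
    exact_mod_cast G.sum_degrees_eq_twice_card_edges
  have hN : 0 < ∑ x, (G.degree x : ℝ) * f x ^ 2 := by
    obtain ⟨x, hx⟩ := Function.ne_iff.1 hf0
    refine Finset.sum_pos' (fun y _ => by positivity) ⟨x, Finset.mem_univ _, ?_⟩
    have := hd x
    have : f x ≠ 0 := hx
    positivity
  set N := ∑ x, (G.degree x : ℝ) * f x ^ 2 with hNdef
  have hpop : 0 ≤ ∑ x, (G.degree x : ℝ) * ((f x - f u) * (f v - f x)) :=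
    Finset.sum_nonneg fun x _ => mul_nonneg (by positivity)
      (mul_nonneg (sub_nonneg.2 (hu x)) (sub_nonneg.2 (hv x)))
  have hexp : ∑ x, (G.degree x : ℝ) * ((f x - f u) * (f v - f x)) =
      (f u + f v) * (∑ x, (G.degree x : ℝ) * f x) - N - f u * f v * ∑ x, (G.degree x : ℝ) := by
    rw [hNdef]
    simp only [Finset.mul_sum, ← Finset.sum_sub_distrib]
    exact Finset.sum_congr rfl fun x _ => by ring
  rw [hexp, hz, hdeg] at hpop
  have hm : (0:ℝ) ≤ numEdges G := by positivity
  have h1 : N ≤ numEdges G * (f v - f u) ^ 2 / 2 := by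
    nlinarith [mul_nonneg hm (sq_nonneg (f u + f v))]
  have h2 := mul_le_mul_of_nonneg_left hcs hm
  have h3 : 1 * N ≤ (2 * (numEdges G : ℝ) * L * (1 - r)) * N := by linarith
  exact le_of_mul_le_mul_right h3 hN

end helpers

/-- For every finite connected graph `G` with `n` vertices, `m` edges and
minimum degree `d`, the relaxation time of the lazy walk satisfies `t_rel ≤ 12 m n / d`. -/
theorem relaxation_time_bound
    {V : Type} [Fintype V] [Nontrivial V] (G : SimpleGraph V) (hG : G.Connected) :
    (relTime (lazyP G) : ℝ) ≤
      12 * (numEdges G : ℝ) * (Fintype.card V : ℝ) / (G.minDegree : ℝ) := by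
  have hdpos : 0 < G.minDegree := hG.preconnected.minDegree_pos_of_nontrivial
  have hd : ∀ x, 0 < G.degree x := fun x => hdpos.trans_le (G.minDegree_le_degree x)
  have hdn : G.minDegree ≤ Fintype.card V := by
    obtain ⟨x⟩ := hG.nonempty
    exact (G.minDegree_le_degree x).trans (G.degree_lt_card_verts x).le
  have hm : 1 ≤ numEdges G := by
    obtain ⟨x⟩ := hG.nonempty
    have h1 : ∑ x, G.degree x = 2 * numEdges G := by
      unfold numEdges
      exact_mod_cast G.sum_degrees_eq_twice_card_edges
    have h2 := Finset.single_le_sum (f := fun x => G.degree x) (fun _ _ => Nat.zero_le _)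
      (Finset.mem_univ x)
    have := hd x
    omega
  set K : ℕ := 12 * numEdges G * Fintype.card V / G.minDegree with hK
  have hKle : (K : ℝ) ≤ 12 * (numEdges G : ℝ) * (Fintype.card V : ℝ) / (G.minDegree : ℝ) := by
    have := Nat.cast_div_le (α := ℝ) (m := 12 * numEdges G * Fintype.card V) (n := G.minDegree)
    push_cast at this
    exact this
  have hK1 : 1 ≤ K := by
    rw [hK, Nat.le_div_iff_mul_le hdpos]
    nlinarith
  have hK1' : (1:ℝ) ≤ K := by exact_mod_cast hK1
  refine le_trans ?_ hKle
  have hsup : secondEig (lazyP G) ≤ 1 - 1 / (K:ℝ) := by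
    refine Real.sSup_le ?_ ?_
    · rintro r ⟨hr, f, hf0, hf⟩
      obtain ⟨L, hL, h1⟩ := aux_gap G hG hd f hf0 r hr hf
      have hLK : 2 * numEdges G * L ≤ K := by
        rw [hK, Nat.le_div_iff_mul_le hdpos]
        nlinarith [Nat.mul_le_mul_left (2 * numEdges G) hL]
      have hLK' : 2 * (numEdges G : ℝ) * L ≤ K := by exact_mod_cast hLK
      have hpos : 0 < 1 - r := by
        by_contra h
        have : 2 * (numEdges G : ℝ) * L * (1 - r) ≤ 0 :=
          mul_nonpos_of_nonneg_of_nonpos (by positivity) (not_lt.1 h)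
        linarith
      have h2 : 1 ≤ (1 - r) * K := by
        nlinarith [mul_le_mul_of_nonneg_right hLK' hpos.le]
      have h3 : 1 / (K:ℝ) ≤ 1 - r := by
        rw [div_le_iff₀ (by linarith)]; exact h2
      linarith
    · have : 1 / (K:ℝ) ≤ 1 := by rw [div_le_one (by linarith)]; exact hK1'
      linarith
  have hKp : 0 < 1 / (K:ℝ) := by positivity
  have : relTime (lazyP G) ≤ K := by
    unfold relTime
    rw [Nat.ceil_le]
    calc 1 / (1 - secondEig (lazyP G)) ≤ 1 / (1 / (K:ℝ)) :=
          one_div_le_one_div_of_le hKp (by linarith)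
      _ = K := by simp
  exact_mod_cast this
end

section
/- Let G=(V,E) be a finite connected graph on n vertices and let P be the transition matrix of the lazy random walk on G. Then for every integer t ≥ 0, the sum of return probabilities satisfies Σ_{u∈V} P^t(u,u) ≤ 1 + 13n/(t+1)^{1/3}. -/
open Finset
open scoped Classical BigOperators

lemma comb {V : Type} [Fintype V] (q R E : V → ℝ) (S T n : ℝ) (hn : 0 < n) (hcard : (Fintype.card V : ℝ) = n)
    (hq : ∀ x, 0 ≤ q x) (hS : S = ∑ x, q x) (hR : ∀ x, 0 ≤ R x)
    (hqR : ∑ x, q x * R x ≤ 2 * n) (hqE : ∑ x, q x * E x ≤ 2 * T)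
    (hE : ∀ x, q x / 2 ≤ E x * R x ^ 2) (hRp : ∀ x, 0 < R x ∨ q x = 0) :
    S ^ 4 / (16 * n ^ 3) ≤ T := by
  have hS0 : 0 ≤ S := hS ▸ Finset.sum_nonneg fun x _ => hq x
  set s := S / n with hs
  have hs0 : 0 ≤ s := by positivity
  have key : ∀ x, s ^ 3 * q x - s^4/4 * (q x * R x) - s^4/4 ≤ 2 * (q x * E x) := by
    intro x
    rcases hRp x with h | h
    · have h1 : q x / 2 / R x ^ 2 ≤ E x := by
        rw [div_le_iff₀ (by positivity)]; exact hE x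
      have h2 : q x * (q x / 2 / R x ^ 2) ≤ q x * E x := mul_le_mul_of_nonneg_left h1 (hq x)
      have h3 : q x * (q x / 2 / R x ^ 2) = (q x / R x)^2 / 2 := by field_simp
      set z := q x / R x with hz
      have hz0 : 0 ≤ z := div_nonneg (hq x) (hR x)
      have hzq : q x = z * R x := by rw [hz]; field_simp
      have h4 : 0 ≤ s^2 * z * (1 - s/2 * R x)^2 := by positivity
      have h5 := sq_nonneg (z - s^2/2)
      rw [hzq] at h2 h3 ⊢
      nlinarith
    · rw [h]; have : 0 ≤ s^4 := by positivity
      linarith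
  have hsum := Finset.sum_le_sum fun x (_ : x ∈ Finset.univ) => key x
  simp only [Finset.sum_sub_distrib, ← Finset.mul_sum, Finset.sum_const, Finset.card_univ, nsmul_eq_mul, hcard, ← hS] at hsum
  have e : S = s * n := by rw [hs]; field_simp
  have h6 : s^4/4 * ∑ x, q x * R x ≤ s^4/4 * (2*n) := mul_le_mul_of_nonneg_left hqR (by positivity)
  have e2 : S ^ 4 / (16 * n ^ 3) = s^4 * n / 16 := by rw [e]; field_simp
  rw [e2]
  rw [e] at hsum
  nlinarith

lemma path_lemma {V : Type} [Fintype V] (G : SimpleGraph V) (hG : G.Connected)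
    {E : Type*} [NormedAddCommGroup E] (F : V → E) (R : Finset V) (x : V)
    (z : V) (hz : z ∉ R) (c : ℝ) (hc : 0 ≤ c)
    (hR : ∀ y, y ∉ R → c ≤ ‖F x - F y‖ ^ 2) :
    c ≤ (∑ u ∈ R, ∑ v, if G.Adj u v then ‖F u - F v‖ ^ 2 else 0) * R.card := by
  obtain ⟨z, hz, hmin⟩ := Finset.exists_min_image (Finset.univ.filter (· ∉ R)) (fun y => G.dist x y) ⟨z, by simpa using hz⟩
  have hz' : z ∉ R := by simpa using hz
  obtain ⟨p, hp⟩ := hG.exists_walk_length_eq_dist x z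
  have hpath := p.isPath_of_length_eq_dist hp
  have hin : ∀ i, i < p.length → p.getVert i ∈ R := by
    intro i hi
    by_contra hcon
    have h1 := hmin (p.getVert i) (by simpa using hcon)
    have h2 : G.dist x (p.getVert i) ≤ (p.take i).length := SimpleGraph.dist_le _
    rw [SimpleGraph.Walk.take_length] at h2
    omega
  have hinj : Set.InjOn p.getVert (Finset.range p.length : Set ℕ) := by
    intro i hi j hj h
    simp at hi hj
    exact hpath.getVert_injOn (by simp; omega) (by simp; omega) h
  have hlen : p.length ≤ R.card := by
    calc p.length = ((Finset.range p.length).image p.getVert).card := by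
          rw [Finset.card_image_of_injOn hinj, Finset.card_range]
      _ ≤ R.card := Finset.card_le_card (by
          intro y hy
          simp only [Finset.mem_image, Finset.mem_range] at hy
          obtain ⟨i, hi, rfl⟩ := hy
          exact hin i hi)
  have htri : ‖F x - F z‖ ≤ ∑ i ∈ Finset.range p.length, ‖F (p.getVert i) - F (p.getVert (i+1))‖ := by
    have := dist_le_range_sum_dist (fun i => F (p.getVert i)) p.length
    simpa [dist_eq_norm] using this
  have hcs : (∑ i ∈ Finset.range p.length, ‖F (p.getVert i) - F (p.getVert (i+1))‖)^2 ≤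
      p.length * ∑ i ∈ Finset.range p.length, ‖F (p.getVert i) - F (p.getVert (i+1))‖^2 := by
    simpa using sq_sum_le_card_mul_sum_sq (s := Finset.range p.length) (f := fun i => ‖F (p.getVert i) - F (p.getVert (i+1))‖)
  have hE : ∑ i ∈ Finset.range p.length, ‖F (p.getVert i) - F (p.getVert (i+1))‖^2 ≤
      ∑ u ∈ R, ∑ v, if G.Adj u v then ‖F u - F v‖ ^ 2 else 0 := by
    calc _ ≤ ∑ i ∈ Finset.range p.length, (fun u => ∑ v, if G.Adj u v then ‖F u - F v‖ ^ 2 else 0) (p.getVert i) := by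
          apply Finset.sum_le_sum
          intro i hi
          have ha := p.adj_getVert_succ (Finset.mem_range.1 hi)
          have := Finset.single_le_sum (f := fun v => if G.Adj (p.getVert i) v then ‖F (p.getVert i) - F v‖ ^ 2 else 0)
            (fun v _ => by positivity) (Finset.mem_univ (p.getVert (i+1)))
          simpa [ha] using this
      _ = ∑ u ∈ (Finset.range p.length).image p.getVert, (fun u => ∑ v, if G.Adj u v then ‖F u - F v‖ ^ 2 else 0) u := by
          rw [Finset.sum_image hinj]
      _ ≤ _ := by
          apply Finset.sum_le_sum_of_subset_of_nonneg
          · intro y hy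
            simp only [Finset.mem_image, Finset.mem_range] at hy
            obtain ⟨i, hi, rfl⟩ := hy
            exact hin i hi
          · intro u _ _
            positivity
  have h0 : 0 ≤ ∑ u ∈ R, ∑ v, if G.Adj u v then ‖F u - F v‖ ^ 2 else 0 := by positivity
  calc c ≤ ‖F x - F z‖^2 := hR z hz'
    _ ≤ _ := pow_le_pow_left₀ (norm_nonneg _) htri 2
    _ ≤ _ := hcs
    _ ≤ R.card * ∑ u ∈ R, ∑ v, if G.Adj u v then ‖F u - F v‖ ^ 2 else 0 := by
      apply mul_le_mul (by exact_mod_cast hlen) hE (by positivity) (by positivity)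
    _ = _ := mul_comm _ _

lemma deg_lemma {V : Type} [Fintype V] (G : SimpleGraph V)
    {E : Type*} [NormedAddCommGroup E] (F : V → E) (R : Finset V) (x : V) (hx : x ∈ R)
    (c : ℝ) (hc : 0 ≤ c)
    (hR : ∀ y, y ∉ R → c ≤ ‖F x - F y‖ ^ 2) :
    c * ((G.degree x : ℝ) - R.card + 1) ≤ (∑ u ∈ R, ∑ v, if G.Adj u v then ‖F u - F v‖ ^ 2 else 0) := by
  calc _ ≤ c * ((G.neighborFinset x \ R).card : ℝ) := by
        apply mul_le_mul_of_nonneg_left _ hc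
        have h1 : (G.neighborFinset x).card ≤ (G.neighborFinset x \ R).card + (R.erase x).card := by
          rw [← Finset.card_sdiff_add_card_inter (G.neighborFinset x) R]
          gcongr
          intro y hy
          simp at hy ⊢
          exact ⟨fun h => by subst h; simp at hy, hy.2⟩
        rw [G.card_neighborFinset_eq_degree, Finset.card_erase_of_mem hx] at h1
        have h2 : 1 ≤ R.card := Finset.card_pos.2 ⟨x, hx⟩
        have h3 : G.degree x + 1 ≤ (G.neighborFinset x \ R).card + R.card := by omega
        have h4 : (G.degree x : ℝ) + 1 ≤ (G.neighborFinset x \ R).card + R.card := by exact_mod_cast h3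
        linarith
    _ = ∑ v ∈ G.neighborFinset x \ R, c := by simp [mul_comm]
    _ ≤ ∑ v ∈ G.neighborFinset x \ R, (if G.Adj x v then ‖F x - F v‖ ^ 2 else 0) := by
        apply Finset.sum_le_sum
        intro v hv
        simp at hv
        simpa [hv.1] using hR v hv.2
    _ ≤ ∑ v, (if G.Adj x v then ‖F x - F v‖ ^ 2 else 0) :=
        Finset.sum_le_sum_of_subset_of_nonneg (Finset.subset_univ _) (fun _ _ _ => by positivity)
    _ ≤ _ := Finset.single_le_sum (f := fun u => ∑ v, if G.Adj u v then ‖F u - F v‖ ^ 2 else 0)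
            (fun v _ => by positivity) hx

lemma embed_bound {V : Type} [Fintype V] (G : SimpleGraph V) (hG : G.Connected)
    {E : Type*} [NormedAddCommGroup E] [InnerProductSpace ℝ E] (F : V → E)
    (hd : ∀ x, 0 < G.degree x)
    (h0 : ∀ x, ∑ y, (G.degree y : ℝ) * inner ℝ (F x) (F y) = 0)
    (h1 : ∀ y, ∑ x, (G.degree x : ℝ) * inner ℝ (F x) (F y) ^ 2 ≤ ‖F y‖ ^ 2) :
    (∑ x, (G.degree x : ℝ) * ‖F x‖ ^ 2) ^ 4 / (16 * (Fintype.card V : ℝ) ^ 3) ≤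
      ∑ u, ∑ v, if G.Adj u v then ‖F u - F v‖ ^ 2 else 0 := by
  have : Nonempty V := hG.nonempty
  set R : V → Finset V := fun x => Finset.univ.filter fun y => ‖F x - F y‖ ^ 2 ≤ ‖F x‖ ^ 2 / 2 with hRdef
  have hxR : ∀ x, x ∈ R x := by intro x; simp [hRdef]; positivity
  have hcard : ∀ x, (1 : ℝ) ≤ (R x).card := fun x => by
    exact_mod_cast Finset.card_pos.2 ⟨x, hxR x⟩
  have hinner : ∀ x y, y ∈ R x → ‖F x‖^2 / 2 + ‖F y‖^2 ≤ 2 * inner ℝ (F x) (F y) := by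
    intro x y h
    simp only [hRdef, Finset.mem_filter, Finset.mem_univ, true_and] at h
    rw [norm_sub_sq_real] at h
    linarith
  have hinner2 : ∀ x y, y ∈ R x → ‖F x‖^2 * ‖F y‖^2 ≤ 2 * inner ℝ (F x) (F y) ^ 2 := by
    intro x y h
    have h2 := hinner x y h
    have h3 : 0 ≤ ‖F x‖^2 / 2 + ‖F y‖^2 := by positivity
    have h4 := pow_le_pow_left₀ h3 h2 2
    nlinarith [sq_nonneg (‖F x‖^2 / 2 - ‖F y‖^2)]
  -- multiplicity
  have hmult : ∀ y, ∑ x, (if y ∈ R x then (G.degree x : ℝ) * ‖F x‖ ^ 2 else 0) ≤ 2 := by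
    intro y
    by_cases hy : F y = 0
    · have : ∀ x, (if y ∈ R x then (G.degree x : ℝ) * ‖F x‖ ^ 2 else 0) = 0 := by
        intro x
        split_ifs with h
        · have := hinner x y h
          simp [hy] at this
          have : ‖F x‖^2 = 0 := le_antisymm (by linarith) (by positivity)
          rw [this, mul_zero]
        · rfl
      simp [this]
    · have hpos : 0 < ‖F y‖^2 := by have := norm_pos_iff.2 hy; positivity
      have h2 : (∑ x, (if y ∈ R x then (G.degree x : ℝ) * ‖F x‖ ^ 2 else 0)) * ‖F y‖^2 ≤ 2 * ‖F y‖^2 := by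
        calc _ ≤ ∑ x, 2 * ((G.degree x : ℝ) * inner ℝ (F x) (F y) ^ 2) := by
              rw [Finset.sum_mul]
              apply Finset.sum_le_sum
              intro x _
              split_ifs with h
              · have := mul_le_mul_of_nonneg_left (hinner2 x y h) (Nat.cast_nonneg (α := ℝ) (G.degree x))
                linarith
              · rw [zero_mul]; positivity
          _ ≤ _ := by
              rw [← Finset.mul_sum]
              exact mul_le_mul_of_nonneg_left (h1 y) (by norm_num)
      exact le_of_mul_le_mul_right h2 hpos
  refine comb (fun x => (G.degree x : ℝ) * ‖F x‖ ^ 2) (fun x => ((R x).card : ℝ))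
    (fun x => ∑ u ∈ R x, ∑ v, if G.Adj u v then ‖F u - F v‖ ^ 2 else 0) _ _ _
    (by exact_mod_cast Fintype.card_pos) rfl (fun x => by positivity) rfl (fun x => by positivity) ?_ ?_ ?_
    (fun x => Or.inl (by linarith [hcard x]))
  · calc _ = ∑ x, ∑ y, (if y ∈ R x then (G.degree x : ℝ) * ‖F x‖ ^ 2 else 0) := by
          apply Finset.sum_congr rfl
          intro x _
          rw [← Finset.sum_filter, Finset.sum_const, nsmul_eq_mul, mul_comm]
          simp
      _ = ∑ y, ∑ x, (if y ∈ R x then (G.degree x : ℝ) * ‖F x‖ ^ 2 else 0) := Finset.sum_comm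
      _ ≤ ∑ y : V, (2 : ℝ) := Finset.sum_le_sum fun y _ => hmult y
      _ = _ := by simp [mul_comm]
  · set e : V → ℝ := fun u => ∑ v, if G.Adj u v then ‖F u - F v‖ ^ 2 else 0 with he
    have he0 : ∀ u, 0 ≤ e u := fun u => by simp only [he]; positivity
    calc _ = ∑ x, ∑ y, (if y ∈ R x then (G.degree x : ℝ) * ‖F x‖ ^ 2 else 0) * e y := by
          apply Finset.sum_congr rfl
          intro x _
          simp only [ite_mul, zero_mul]
          rw [← Finset.sum_filter, ← Finset.mul_sum]
          simp
      _ = ∑ y, (∑ x, (if y ∈ R x then (G.degree x : ℝ) * ‖F x‖ ^ 2 else 0)) * e y := by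
          rw [Finset.sum_comm]; simp only [Finset.sum_mul]
      _ ≤ ∑ y : V, 2 * e y := Finset.sum_le_sum fun y _ => mul_le_mul_of_nonneg_right (hmult y) (he0 y)
      _ = _ := by rw [Finset.mul_sum]
  · intro x
    have hE0 : 0 ≤ ∑ u ∈ R x, ∑ v, if G.Adj u v then ‖F u - F v‖ ^ 2 else 0 := by positivity
    have hout : ∀ y, y ∉ R x → ‖F x‖ ^ 2 / 2 ≤ ‖F x - F y‖ ^ 2 := by
      intro y hy
      simp [hRdef] at hy
      exact hy.le
    by_cases hF : F x = 0
    · simp only [hF]; simp; positivity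
    have hpos : 0 < ‖F x‖^2 := by have := norm_pos_iff.2 hF; positivity
    have hz : ∃ z, z ∉ R x := by
      by_contra! hall
      have : 0 < ∑ y, (G.degree y : ℝ) * inner ℝ (F x) (F y) := by
        apply Finset.sum_pos _ Finset.univ_nonempty
        intro y _
        have hp : (0 : ℝ) < G.degree y := by exact_mod_cast hd y
        have := hinner x y (hall y)
        have : 0 < inner ℝ (F x) (F y) := by nlinarith [sq_nonneg ‖F y‖]
        positivity
      linarith [h0 x]
    obtain ⟨z, hz⟩ := hz
    have hA := path_lemma G hG F (R x) x z hz (‖F x‖ ^ 2 / 2) (by positivity) hout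
    have hB := deg_lemma G F (R x) x (hxR x) (‖F x‖ ^ 2 / 2) (by positivity) hout
    set EE := ∑ u ∈ R x, ∑ v, if G.Adj u v then ‖F u - F v‖ ^ 2 else 0 with hEE
    have hr := hcard x
    set r : ℝ := ((R x).card : ℝ) with hrr
    set d : ℝ := (G.degree x : ℝ) with hdd
    have hd0 : 0 ≤ d := by positivity
    rcases le_total d r with h | h
    · have := mul_le_mul_of_nonneg_right hA (by linarith : 0 ≤ r)
      nlinarith
    · have h3 : d ≤ (d - r + 1) * r ^ 2 := by
        have : d ≤ (d-r+1) * r := by nlinarith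
        nlinarith [mul_nonneg (by linarith : 0 ≤ d - r + 1) (by linarith : 0 ≤ r)]
      have h4 := mul_le_mul_of_nonneg_right hB (by positivity : 0 ≤ r^2)
      nlinarith

noncomputable def symW {V : Type} [Fintype V] (G : SimpleGraph V) : Matrix V V ℝ :=
  fun u v => if G.Adj u v then 1 / (√(G.degree u : ℝ) * √(G.degree v : ℝ)) else 0

noncomputable def symM {V : Type} [Fintype V] (G : SimpleGraph V) : Matrix V V ℝ :=
  (1 / 2 : ℝ) • (1 + symW G)

lemma sum_adj_left {V : Type} [Fintype V] (G : SimpleGraph V) (g : V → ℝ) :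
    ∑ u, ∑ v, (if G.Adj u v then g u else 0) = ∑ u, (G.degree u : ℝ) * g u := by
  apply Finset.sum_congr rfl
  intro u _
  rw [← Finset.sum_filter, Finset.sum_const, nsmul_eq_mul, ← G.card_neighborFinset_eq_degree]
  congr 3
  ext v; simp

lemma sum_adj_right {V : Type} [Fintype V] (G : SimpleGraph V) (g : V → ℝ) :
    ∑ u, ∑ v, (if G.Adj u v then g v else 0) = ∑ u, (G.degree u : ℝ) * g u := by
  rw [Finset.sum_comm, ← sum_adj_left]
  simp only [G.adj_comm]

lemma symW_symm {V : Type} [Fintype V] (G : SimpleGraph V) : (symW G).IsHermitian := by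
  ext u v
  simp [symW, Matrix.conjTranspose_apply, G.adj_comm, mul_comm]

lemma symW_psd {V : Type} [Fintype V] (G : SimpleGraph V) (hd : ∀ x, 0 < G.degree x)
    (e : ℝ) (he : e ^ 2 = 1) : (1 + e • symW G).PosSemidef := by
  apply Matrix.PosSemidef.of_dotProduct_mulVec_nonneg
  · apply Matrix.IsHermitian.add Matrix.isHermitian_one
    have := symW_symm G
    unfold Matrix.IsHermitian at this ⊢
    rw [Matrix.conjTranspose_smul, this]; simp
  intro x
  set a : V → ℝ := fun u => x u / √(G.degree u : ℝ) with ha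
  have hs : ∀ u, √(G.degree u : ℝ) ≠ 0 := fun u => by
    have : (0 : ℝ) < G.degree u := by exact_mod_cast hd u
    positivity
  have key : star x ⬝ᵥ (1 + e • symW G).mulVec x = (1/2) * ∑ u, ∑ v, if G.Adj u v then (a u + e * a v) ^ 2 else 0 := by
    have h1 : ∀ u v, (if G.Adj u v then (a u + e * a v) ^ 2 else 0) =
        (if G.Adj u v then a u ^ 2 else 0) + (if G.Adj u v then a v ^ 2 else 0) + 2 * e * (x u * (symW G u v * x v)) := by
      intro u v
      simp only [symW, ha]
      split_ifs with h
      · have := hs u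
        have := hs v
        have h3 : (x u / √(G.degree u : ℝ) + e * (x v / √(G.degree v : ℝ))) ^ 2 = (x u / √(G.degree u : ℝ))^2 + e^2 * (x v / √(G.degree v : ℝ))^2 + 2 * e * (x u / √(G.degree u : ℝ)) * (x v / √(G.degree v : ℝ)) := by ring
        rw [h3, he]; field_simp
      · simp
    simp only [h1, Finset.sum_add_distrib, sum_adj_left G (fun u => a u ^ 2), sum_adj_right G (fun u => a u ^ 2)]
    have h2 : ∀ u, (G.degree u : ℝ) * a u ^ 2 = x u * x u := by
      intro u
      have := hs u
      have h4 := Real.sq_sqrt (Nat.cast_nonneg (α := ℝ) (G.degree u))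
      simp only [ha]; rw [div_pow, h4]
      have : (G.degree u : ℝ) ≠ 0 := by exact_mod_cast (hd u).ne'
      field_simp
    simp only [h2]
    rw [Matrix.add_mulVec, dotProduct_add, Matrix.one_mulVec, Matrix.smul_mulVec, dotProduct_smul]
    simp only [dotProduct, Matrix.mulVec, ← Finset.mul_sum, star_trivial, smul_eq_mul]
    ring
  rw [key]
  positivity

lemma symM_psd {V : Type} [Fintype V] (G : SimpleGraph V) (hd : ∀ x, 0 < G.degree x) :
    (symM G).PosSemidef := by
  have := (symW_psd G hd 1 (by norm_num)).smul (by norm_num : (0:ℝ) ≤ 1/2)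
  simpa [symM] using this

lemma symM_psd' {V : Type} [Fintype V] (G : SimpleGraph V) (hd : ∀ x, 0 < G.degree x) :
    (1 - symM G).PosSemidef := by
  have := (symW_psd G hd (-1) (by norm_num)).smul (by norm_num : (0:ℝ) ≤ 1/2)
  convert this using 1
  ext u v; simp [symM]; ring

lemma psd_anti {V : Type} [Fintype V] (M : Matrix V V ℝ) (h : M.PosSemidef) (h' : (1 - M).PosSemidef) (t : ℕ) :
    (M ^ t - M ^ (t+1)).PosSemidef := by
  have hM : M.conjTranspose = M := h.1
  have hM' : (1 - M).conjTranspose = 1 - M := h'.1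
  have hp : ∀ s, (M ^ s).conjTranspose = M ^ s := fun s => by rw [Matrix.conjTranspose_pow, hM]
  rcases Nat.even_or_odd' t with ⟨s, rfl | rfl⟩
  · have := h'.conjTranspose_mul_mul_same (M ^ s)
    rw [hp] at this
    convert this using 1
    rw [mul_sub, sub_mul, mul_one, ← pow_succ, ← pow_add, ← pow_add]
    congr 2 <;> omega
  · have hA : (M - M ^ 2).PosSemidef := by
      have h1 := h'.conjTranspose_mul_mul_same M
      have h2 := h.conjTranspose_mul_mul_same (1 - M)
      rw [hM] at h1
      rw [hM'] at h2
      convert h1.add h2 using 1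
      noncomm_ring
    have := hA.conjTranspose_mul_mul_same (M ^ s)
    rw [hp] at this
    convert this using 1
    rw [mul_sub, sub_mul, ← pow_succ, ← pow_add, ← pow_add, ← pow_add]
    congr 2 <;> omega

lemma diag_anti {V : Type} [Fintype V] (M : Matrix V V ℝ) (h : M.PosSemidef) (h' : (1 - M).PosSemidef) (y : V) :
    Antitone fun t : ℕ => (M ^ t) y y := by
  apply antitone_nat_of_succ_le
  intro t
  have := (psd_anti M h h' t).diag_nonneg (i := y)
  simp at this
  linarith

lemma pow_conj {V : Type} [Fintype V] (G : SimpleGraph V) (hd : ∀ x, 0 < G.degree x) (t : ℕ) (x y : V) :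
    √(G.degree x : ℝ) * (lazyP G ^ t) x y = (symM G ^ t) x y * √(G.degree y : ℝ) := by
  have hs : ∀ u, √(G.degree u : ℝ) ≠ 0 := fun u => by
    have : (0 : ℝ) < G.degree u := by exact_mod_cast hd u
    positivity
  have h1 : Matrix.diagonal (fun x => √(G.degree x : ℝ)) * lazyP G = symM G * Matrix.diagonal (fun x => √(G.degree x : ℝ)) := by
    ext u v
    rw [Matrix.diagonal_mul, Matrix.mul_diagonal]
    simp only [lazyP, symM, symW, Matrix.smul_apply, Matrix.add_apply, Matrix.one_apply, smul_eq_mul]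
    have h4 := Real.mul_self_sqrt (Nat.cast_nonneg (α := ℝ) (G.degree u))
    by_cases huv : u = v
    · subst huv; simp; ring
    · by_cases ha : G.Adj u v
      · simp only [huv, ha, if_true, if_false]
        have := hs u
        have := hs v
        have : (G.degree u : ℝ) ≠ 0 := by exact_mod_cast (hd u).ne'
        field_simp
        nlinarith
      · simp [huv, ha]
  have h2 : Matrix.diagonal (fun x => √(G.degree x : ℝ)) * lazyP G ^ t = symM G ^ t * Matrix.diagonal (fun x => √(G.degree x : ℝ)) := 
    (SemiconjBy.pow_right (a := Matrix.diagonal (fun x => √(G.degree x : ℝ))) h1 t)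
  have := congrFun (congrFun h2 x) y
  rwa [Matrix.diagonal_mul, Matrix.mul_diagonal] at this

lemma trace_eq {V : Type} [Fintype V] (G : SimpleGraph V) (hd : ∀ x, 0 < G.degree x) (t : ℕ) :
    ∑ u, (lazyP G ^ t) u u = ∑ u, (symM G ^ t) u u := by
  apply Finset.sum_congr rfl
  intro u _
  have h := pow_conj G hd t u u
  have : (0 : ℝ) < G.degree u := by exact_mod_cast hd u
  have hs : √(G.degree u : ℝ) ≠ 0 := by positivity
  rw [mul_comm] at h
  exact mul_right_cancel₀ hs h

lemma symM_fix {V : Type} [Fintype V] (G : SimpleGraph V) (hd : ∀ x, 0 < G.degree x) :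
    (symM G).mulVec (fun x => √(G.degree x : ℝ)) = fun x => √(G.degree x : ℝ) := by
  have hs : ∀ u, √(G.degree u : ℝ) ≠ 0 := fun u => by
    have : (0 : ℝ) < G.degree u := by exact_mod_cast hd u
    positivity
  have hW : (symW G).mulVec (fun x => √(G.degree x : ℝ)) = fun x => √(G.degree x : ℝ) := by
    ext u
    simp only [Matrix.mulVec, dotProduct, symW]
    have : ∀ v, (if G.Adj u v then 1 / (√(G.degree u : ℝ) * √(G.degree v : ℝ)) else 0) * √(G.degree v : ℝ) = if G.Adj u v then 1 / √(G.degree u : ℝ) else 0 := by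
      intro v
      have := hs u
      have := hs v
      split_ifs
      · field_simp
      · simp
    simp only [this]
    rw [← Finset.sum_filter, Finset.sum_const, nsmul_eq_mul]
    have h5 : (Finset.univ.filter (fun v => G.Adj u v)).card = G.degree u := by
      rw [← G.card_neighborFinset_eq_degree]; congr 1; ext v; simp
    rw [h5]
    have h4 := Real.mul_self_sqrt (Nat.cast_nonneg (α := ℝ) (G.degree u))
    have := hs u
    field_simp
    nlinarith
  rw [symM, Matrix.smul_mulVec, Matrix.add_mulVec, hW, Matrix.one_mulVec]
  ext u; simp; ring

/-- Stationary projection. -/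
noncomputable def symJ {V : Type} [Fintype V] (G : SimpleGraph V) : Matrix V V ℝ :=
  fun u v => √(G.degree u : ℝ) * √(G.degree v : ℝ) / ∑ x, (G.degree x : ℝ)

lemma M_J {V : Type} [Fintype V] (G : SimpleGraph V) (hd : ∀ x, 0 < G.degree x) :
    symM G * symJ G = symJ G := by
  ext u v
  have := congrFun (symM_fix G hd) u
  simp only [Matrix.mulVec, dotProduct] at this
  simp only [Matrix.mul_apply, symJ]
  rw [← this, Finset.sum_mul, Finset.sum_div]
  apply Finset.sum_congr rfl
  intro x _; ring

lemma J_symm {V : Type} [Fintype V] (G : SimpleGraph V) : (symJ G).conjTranspose = symJ G := by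
  ext u v; simp [symJ, Matrix.conjTranspose_apply, mul_comm]

lemma J_M {V : Type} [Fintype V] (G : SimpleGraph V) (hd : ∀ x, 0 < G.degree x) :
    symJ G * symM G = symJ G := by
  have h := congrArg Matrix.conjTranspose (M_J G hd)
  rw [Matrix.conjTranspose_mul, J_symm, (symM_psd G hd).1] at h
  exact h

lemma J_fix {V : Type} [Fintype V] [Nonempty V] (G : SimpleGraph V) (hd : ∀ x, 0 < G.degree x) (x : V) :
    ∑ y, symJ G x y * √(G.degree y : ℝ) = √(G.degree x : ℝ) := by
  have hD : 0 < ∑ x, (G.degree x : ℝ) := Finset.sum_pos (fun x _ => by exact_mod_cast hd x) Finset.univ_nonempty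
  have : ∀ y, symJ G x y * √(G.degree y : ℝ) = √(G.degree x : ℝ) / (∑ x, (G.degree x : ℝ)) * (G.degree y : ℝ) := by
    intro y
    have h4 := Real.mul_self_sqrt (Nat.cast_nonneg (α := ℝ) (G.degree y))
    simp only [symJ]
    rw [div_mul_eq_mul_div, mul_assoc, h4]; ring
  simp only [this, ← Finset.mul_sum]
  field_simp

lemma J_J {V : Type} [Fintype V] [Nonempty V] (G : SimpleGraph V) (hd : ∀ x, 0 < G.degree x) :
    symJ G * symJ G = symJ G := by
  ext u v
  have := J_fix G hd u
  rw [Matrix.mul_apply]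
  conv_rhs => rw [symJ, ← this, Finset.sum_mul, Finset.sum_div]
  apply Finset.sum_congr rfl
  intro x _; simp only [symJ]; ring

lemma J_trace {V : Type} [Fintype V] [Nonempty V] (G : SimpleGraph V) (hd : ∀ x, 0 < G.degree x) :
    ∑ x, symJ G x x = 1 := by
  have hD : 0 < ∑ x, (G.degree x : ℝ) := Finset.sum_pos (fun x _ => by exact_mod_cast hd x) Finset.univ_nonempty
  have : ∀ y, symJ G y y  = (G.degree y : ℝ) / (∑ x, (G.degree x : ℝ)) := by
    intro y
    have h4 := Real.mul_self_sqrt (Nat.cast_nonneg (α := ℝ) (G.degree y))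
    simp only [symJ]; rw [h4]
  simp only [this, ← Finset.sum_div]
  field_simp

lemma pow_J {V : Type} [Fintype V] (G : SimpleGraph V) (hd : ∀ x, 0 < G.degree x) (t : ℕ) :
    symM G ^ t * symJ G = symJ G ∧ symJ G * symM G ^ t = symJ G := by
  induction t with
  | zero => simp
  | succ t ih =>
    constructor
    · rw [pow_succ, mul_assoc, M_J G hd, ih.1]
    · rw [pow_succ, ← mul_assoc, ih.2, J_M G hd]

lemma step {V : Type} [Fintype V] [Nonempty V] (G : SimpleGraph V) (hG : G.Connected)
    (hd : ∀ x, 0 < G.degree x) (t : ℕ) :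
    0 ≤ ∑ u, (symM G ^ t) u u - 1 ∧
    (∑ u, (symM G ^ t) u u - 1) ^ 4 / (64 * (Fintype.card V : ℝ) ^ 3) ≤
      ∑ u, (symM G ^ t) u u - ∑ u, (symM G ^ (t+1)) u u := by
  have hs : ∀ u, √(G.degree u : ℝ) ≠ 0 := fun u => by
    have : (0 : ℝ) < G.degree u := by exact_mod_cast hd u
    positivity
  have hss : ∀ u, √(G.degree u : ℝ) * √(G.degree u : ℝ) = (G.degree u : ℝ) := fun u =>
    Real.mul_self_sqrt (Nat.cast_nonneg (α := ℝ) (G.degree u))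
  set K := symM G ^ t - symJ G with hK
  obtain ⟨hp1, hp2⟩ := pow_J G hd t
  have hKpsd : K.PosSemidef := by
    have h1 := ((symM_psd G hd).pow t).conjTranspose_mul_mul_same (1 - symJ G)
    have h2 : (1 - symJ G).conjTranspose = 1 - symJ G := by
      rw [Matrix.conjTranspose_sub, J_symm, Matrix.conjTranspose_one]
    rw [h2] at h1
    convert h1 using 1
    rw [sub_mul, one_mul, hp2, mul_sub, mul_one, sub_mul, hp1, J_J G hd, sub_self, sub_zero]
  have hKs : ∀ x, ∑ y, K x y * √(G.degree y : ℝ) = 0 := by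
    intro x
    have e : (K * symJ G) = 0 := by rw [hK, sub_mul, hp1, J_J G hd, sub_self]
    have e2 : K.mulVec ((symJ G).mulVec (fun y => √(G.degree y : ℝ))) = 0 := by
      rw [Matrix.mulVec_mulVec, e, Matrix.zero_mulVec]
    have e3 : (symJ G).mulVec (fun y => √(G.degree y : ℝ)) = fun y => √(G.degree y : ℝ) := by
      ext x; exact J_fix G hd x
    rw [e3] at e2
    exact congrFun e2 x
  have hKsym : ∀ x y, K x y = K y x := by
    intro x y
    have := congrFun (congrFun hKpsd.1 y) x
    simpa [Matrix.conjTranspose_apply] using this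
  have hKK : ∀ y, ∑ x, K x y ^ 2 ≤ K y y := by
    intro y
    have e : K * K = symM G ^ (2 * t) - symJ G := by
      rw [hK, sub_mul, mul_sub, mul_sub, hp1, hp2, J_J G hd, sub_self, sub_zero, ← pow_add, two_mul]
    have e1 : (K * K) y y = ∑ x, K x y ^ 2 := by
      rw [Matrix.mul_apply]
      apply Finset.sum_congr rfl
      intro x _
      rw [hKsym y x, sq]
    rw [← e1, e, hK, Matrix.sub_apply, Matrix.sub_apply]
    have := diag_anti _ (symM_psd G hd) (symM_psd' G hd) y (by omega : t ≤ 2 * t)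
    simp only at this
    linarith
  have htr : ∑ u, K u u = ∑ u, (symM G ^ t) u u - 1 := by
    simp only [hK, Matrix.sub_apply, Finset.sum_sub_distrib, J_trace G hd]
  obtain ⟨B, hB⟩ : ∃ B : Matrix V V ℝ, K = B.conjTranspose * B := by
    open scoped MatrixOrder in
    exact CStarAlgebra.nonneg_iff_eq_star_mul_self.1 hKpsd.nonneg
  set F : V → EuclideanSpace ℝ V := fun x => (1 / √(G.degree x : ℝ)) • WithLp.toLp 2 (fun i => B i x) with hF
  have hin : ∀ x y, inner ℝ (F x) (F y) = K x y / (√(G.degree x : ℝ) * √(G.degree y : ℝ)) := by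
    intro x y
    simp only [hF]
    rw [real_inner_smul_left, real_inner_smul_right, EuclideanSpace.inner_eq_star_dotProduct, hB, Matrix.mul_apply]
    simp only [dotProduct, Matrix.conjTranspose_apply, star_trivial, Pi.star_apply]
    have : ∑ i, B i y * B i x = ∑ i, B i x * B i y := Finset.sum_congr rfl fun i _ => mul_comm _ _
    rw [this]
    have := hs x
    have := hs y
    field_simp
  have hnorm : ∀ x, ‖F x‖ ^ 2 = K x x / (G.degree x : ℝ) := by
    intro x
    rw [← real_inner_self_eq_norm_sq, hin, hss]
  have hdd : ∀ x, (G.degree x : ℝ) ≠ 0 := fun x => by exact_mod_cast (hd x).ne'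
  have hmain := embed_bound G hG F hd ?_ ?_
  · have e1 : ∑ x, (G.degree x : ℝ) * ‖F x‖ ^ 2 = ∑ u, (symM G ^ t) u u - 1 := by
      rw [← htr]
      apply Finset.sum_congr rfl
      intro x _
      rw [hnorm]; have := hdd x; field_simp
    have e2 : ∑ u, ∑ v, (if G.Adj u v then ‖F u - F v‖ ^ 2 else 0) =
        4 * (∑ u, (symM G ^ t) u u - ∑ u, (symM G ^ (t+1)) u u) := by
      have h1 : ∀ u v, (if G.Adj u v then ‖F u - F v‖ ^ 2 else 0) =
          (if G.Adj u v then K u u / (G.degree u : ℝ) else 0) + (if G.Adj u v then K v v / (G.degree v : ℝ) else 0)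
          - 2 * (symW G u v * K v u) := by
        intro u v
        simp only [symW]
        split_ifs with h
        · rw [norm_sub_sq_real, hnorm, hnorm, hin, hKsym v u]; ring
        · simp
      simp only [h1, Finset.sum_add_distrib, Finset.sum_sub_distrib]
      rw [sum_adj_left G (fun u => K u u / (G.degree u : ℝ)), sum_adj_right G (fun u => K u u / (G.degree u : ℝ))]
      have h2 : ∀ u, (G.degree u : ℝ) * (K u u / (G.degree u : ℝ)) = K u u := fun u => by
        have := hdd u; field_simp
      simp only [h2, ← Finset.mul_sum]
      have h3 : symW G * K = (2 : ℝ) • (symM G ^ (t+1) - symJ G) - K := by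
        have : symW G = (2 : ℝ) • symM G - 1 := by
          rw [symM, smul_smul]; norm_num
        rw [this, sub_mul, one_mul, Matrix.smul_mul, hK, mul_sub, M_J G hd, ← pow_succ']
      have h4 : ∑ u, ∑ v, symW G u v * K v u = ∑ u, (symW G * K) u u := by
        simp only [Matrix.mul_apply]
      rw [h4, h3]
      simp only [Matrix.sub_apply, Matrix.smul_apply, Finset.sum_sub_distrib, htr, smul_eq_mul, ← Finset.mul_sum, J_trace G hd]
      ring
    rw [e1, e2] at hmain
    refine ⟨htr ▸ Finset.sum_nonneg fun u _ => hKpsd.diag_nonneg, ?_⟩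
    have e3 : (∑ u, (symM G ^ t) u u - 1) ^ 4 / (64 * (Fintype.card V : ℝ) ^ 3) = (∑ u, (symM G ^ t) u u - 1) ^ 4 / (16 * (Fintype.card V : ℝ) ^ 3) / 4 := by
      rw [div_div]; congr 1; ring
    rw [e3]; linarith
  · intro x
    have : ∀ y, (G.degree y : ℝ) * inner ℝ (F x) (F y) = (1 / √(G.degree x : ℝ)) * (K x y * √(G.degree y : ℝ)) := by
      intro y
      rw [hin]
      have := hs x
      have := hs y
      nth_rw 1 [← hss y]
      field_simp
    simp only [this, ← Finset.mul_sum, hKs, mul_zero]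
  · intro y
    have : ∀ x, (G.degree x : ℝ) * inner ℝ (F x) (F y) ^ 2 = (1 / (G.degree y : ℝ)) * K x y ^ 2 := by
      intro x
      rw [hin, div_pow, mul_pow, sq (√(G.degree x : ℝ)), sq (√(G.degree y : ℝ)), hss, hss]
      have := hdd x
      have := hdd y
      field_simp
    simp only [this, ← Finset.mul_sum]
    rw [hnorm, div_eq_mul_one_div (K y y)]
    have hnn : (0 : ℝ) ≤ 1 / (G.degree y : ℝ) := by positivity
    rw [mul_comm (K y y)]
    exact mul_le_mul_of_nonneg_left (hKK y) hnn

lemma recur (a : ℕ → ℝ) (h0 : ∀ t, 0 ≤ a t) (h1 : a 0 ≤ 1) (hstep : ∀ t, a t ^ 4 / 64 ≤ a t - a (t+1)) (t : ℕ) :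
    a t ^ 3 * (t + 1) ≤ 64 := by
  induction t with
  | zero => have := pow_le_one₀ (h0 0) h1 (n := 3); norm_num; linarith
  | succ t ih =>
    have hs := hstep t
    have p := h0 t
    have p' := h0 (t+1)
    set s := a t
    set s' := a (t+1)
    rcases p.eq_or_lt with h | h
    · have : s' = 0 := by rw [← h] at hs; norm_num at hs; linarith
      rw [this]; norm_num
    set b := s ^ 3 with hb
    have hbpos : 0 < b := by positivity
    have hs2 : s' ≤ s * (1 - b / 64) := by rw [hb]; linarith
    have hpos : 0 ≤ 1 - b / 64 := by
      by_contra hcon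
      push Not at hcon
      nlinarith
    have h3 : s' ^ 3 ≤ b * (1 - b/64) := by
      calc s' ^ 3 ≤ (s * (1 - b/64)) ^ 3 := pow_le_pow_left₀ p' hs2 3
        _ = b * (1 - b/64) ^ 3 := by rw [hb]; ring
        _ ≤ b * (1 - b/64) := by
          apply mul_le_mul_of_nonneg_left _ hbpos.le
          exact pow_le_of_le_one hpos (by linarith) (by norm_num)
    have h4 : s' ^ 3 * (1 + b/64) ≤ b := by
      have := mul_le_mul_of_nonneg_right h3 (by linarith : 0 ≤ 1 + b/64)
      nlinarith [pow_pos hbpos 3]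
    push_cast
    have ht : (0:ℝ) ≤ t := by positivity
    by_contra hcon
    push Not at hcon
    nlinarith [mul_pos (by linarith : 0 < 1 + b/64) (by linarith : (0:ℝ) < t + 1 + 1)]

/-- For every finite connected graph `G` on `n` vertices and every `t ≥ 0`,
the sum of return probabilities of the lazy walk satisfies
`∑_u P^t(u,u) ≤ 1 + 13 n / (t+1)^{1/3}`. -/
theorem sum_return_probabilities_bound
    {V : Type} [Fintype V] (G : SimpleGraph V) (hG : G.Connected) (t : ℕ) :
    ∑ u : V, (lazyP G ^ t) u u ≤
      1 + 13 * (Fintype.card V : ℝ) / ((t : ℝ) + 1) ^ ((1 : ℝ) / 3) := by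
  have hne : Nonempty V := hG.nonempty
  have hn : (0 : ℝ) < Fintype.card V := by exact_mod_cast Fintype.card_pos
  have hr : (0 : ℝ) < ((t : ℝ) + 1) ^ ((1 : ℝ) / 3) := by positivity
  rcases subsingleton_or_nontrivial V with hV | hV
  · have h1 : lazyP G = (1/2 : ℝ) • (1 : Matrix V V ℝ) := by
      ext u v
      have : u = v := Subsingleton.elim _ _
      subst this
      simp [lazyP]
    have h2 : ∑ u : V, (lazyP G ^ t) u u ≤ 1 := by
      obtain ⟨x⟩ := hne
      rw [Fintype.sum_subsingleton _ x, h1, smul_pow, one_pow]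
      simp only [Matrix.smul_apply, Matrix.one_apply_eq, smul_eq_mul, mul_one]
      exact pow_le_one₀ (by norm_num) (by norm_num)
    have : 0 ≤ 13 * (Fintype.card V : ℝ) / ((t : ℝ) + 1) ^ ((1 : ℝ) / 3) := by positivity
    linarith
  have hd : ∀ x, 0 < G.degree x := fun x => hG.preconnected.degree_pos_of_nontrivial x
  have hrec := recur (fun t => (∑ u, (symM G ^ t) u u - 1) / Fintype.card V)
    (fun t => div_nonneg (step G hG hd t).1 hn.le)
    (by rw [div_le_one hn]; simp)
    (fun t => by
      have h := (step G hG hd t).2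
      have h2 := div_le_div_of_nonneg_right h hn.le
      calc _ = (∑ u, (symM G ^ t) u u - 1) ^ 4 / (64 * (Fintype.card V : ℝ) ^ 3) / Fintype.card V := by
            field_simp
        _ ≤ _ := h2
        _ = _ := by ring) t
  have hnn : 0 ≤ (∑ u, (symM G ^ t) u u - 1) / Fintype.card V := div_nonneg (step G hG hd t).1 hn.le
  rw [trace_eq G hd]
  set a := (∑ u, (symM G ^ t) u u - 1) / Fintype.card V with ha
  have hr3 : (((t : ℝ) + 1) ^ ((1 : ℝ) / 3)) ^ 3 = (t : ℝ) + 1 := by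
    rw [← Real.rpow_natCast, ← Real.rpow_mul (by positivity)]; norm_num
  set r := ((t : ℝ) + 1) ^ ((1 : ℝ) / 3)
  have h4 : a * r ≤ 4 := by
    apply le_of_pow_le_pow_left₀ (n := 3) (by norm_num) (by norm_num)
    rw [mul_pow, hr3]; linarith
  have h5 : ∑ u, (symM G ^ t) u u - 1 = a * Fintype.card V := by rw [ha]; field_simp
  have h6 : a * Fintype.card V ≤ 13 * (Fintype.card V : ℝ) / r := by
    rw [le_div_iff₀ hr]
    nlinarith
  linarith
end

section
/- Let G=(V,E) be a finite connected graph with lazy random walk transition matrix P, stationary distribution π, relaxation time t_rel, and Green's function g_t. Then for every vertex x and every integer t ≥ 1, Σ_{i,j=0}^{t−1} (P^{i+j}(x,x)/π(x) − 1) ≤ (t_rel/(1−1/e)²)·g_{t_rel}(x,x)/π(x). -/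
open Finset
open scoped Classical BigOperators

lemma lrw_mulVec {V : Type} [Fintype V] (G : SimpleGraph V) (f : V → ℝ) (u : V) :
    (lazyP G).mulVec f u = 1 / 2 * f u +
      1 / (2 * (G.degree u : ℝ)) * ∑ v ∈ G.neighborFinset u, f v := by
  have h : ∀ v, lazyP G u v * f v = (if u = v then 1 / 2 * f v else 0) +
      (if v ∈ G.neighborFinset u then 1 / (2 * (G.degree u : ℝ)) * f v else 0) := by
    intro v
    unfold lazyP
    by_cases h1 : u = v
    · subst h1; simp
    · by_cases h2 : G.Adj u v <;> simp [h1, h2]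
  simp only [Matrix.mulVec, dotProduct, h, Finset.sum_add_distrib, Finset.sum_ite_eq,
    Finset.mem_univ, if_true, Finset.sum_ite_mem, Finset.univ_inter, Finset.mul_sum]

lemma lrw_eig_bounds {V : Type} [Fintype V] [Nontrivial V] (G : SimpleGraph V)
    (hd : ∀ u, (0 : ℝ) < G.degree u) (r : ℝ) (f : V → ℝ) (hf : f ≠ 0)
    (h : (lazyP G).mulVec f = r • f) : 0 ≤ r ∧ r ≤ 1 := by
  obtain ⟨u, hu⟩ := Finite.exists_max (fun v => |f v|)
  have hpos : 0 < |f u| := by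
    by_contra hc
    apply hf
    funext v
    have := hu v
    have h2 := abs_nonneg (f v)
    exact abs_eq_zero.1 (le_antisymm (by simpa using this.trans (not_lt.1 hc)) h2)
  have e := congrFun h u
  rw [lrw_mulVec] at e
  simp only [Pi.smul_apply, smul_eq_mul] at e
  have hs : |∑ v ∈ G.neighborFinset u, f v| ≤ G.degree u * |f u| := by
    refine (Finset.abs_sum_le_sum_abs _ _).trans ?_
    refine (Finset.sum_le_sum (fun v _ => hu v)).trans ?_
    simp
  have hdu := hd u
  have e2 : (r - 1/2) * f u = 1 / (2 * (G.degree u : ℝ)) * ∑ v ∈ G.neighborFinset u, f v := by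
    linarith
  have e3 : |r - 1/2| * |f u| ≤ 1/2 * |f u| := by
    rw [← abs_mul, e2, abs_mul, abs_of_pos (by positivity)]
    calc _ ≤ 1 / (2 * (G.degree u : ℝ)) * (G.degree u * |f u|) := by gcongr
      _ = _ := by field_simp
  have e4 := le_of_mul_le_mul_right e3 hpos
  rw [abs_le] at e4
  constructor <;> linarith [e4.1, e4.2]

lemma lrw_harm {V : Type} [Fintype V] [Nontrivial V] (G : SimpleGraph V) (hG : G.Connected)
    (hd : ∀ u, (0 : ℝ) < G.degree u) (f : V → ℝ)
    (h : (lazyP G).mulVec f = f) (u v : V) : f u = f v := by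
  have : (G.lapMatrix ℝ).mulVec f = 0 := by
    funext u
    have e := congrFun h u
    rw [lrw_mulVec] at e
    rw [SimpleGraph.lapMatrix_mulVec_apply]
    have := hd u
    field_simp at e
    simp only [Pi.zero_apply]
    linarith
  exact ((SimpleGraph.lapMatrix_mulVec_eq_zero_iff_forall_reachable G).1 this) u v (hG.preconnected u v)

lemma lrw_one {V : Type} [Fintype V] (G : SimpleGraph V)
    (hd : ∀ u, (0 : ℝ) < G.degree u) : (lazyP G).mulVec (fun _ => 1) = fun _ => 1 := by
  funext u
  rw [lrw_mulVec]
  have := hd u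
  simp
  field_simp
  norm_num

lemma lrw_second {V : Type} [Fintype V] [Nontrivial V] (G : SimpleGraph V)
    (hd : ∀ u, (0 : ℝ) < G.degree u) (r : ℝ) (hr : r ≠ 1) (f : V → ℝ) (hf : f ≠ 0)
    (h : (lazyP G).mulVec f = r • f) : 1 / (1 - r) ≤ relTime (lazyP G) := by
  set s := {r : ℝ | r ≠ 1 ∧ ∃ f : V → ℝ, f ≠ 0 ∧ (lazyP G).mulVec f = r • f} with hs
  have hfin : s.Finite := by
    refine (Module.End.finite_hasEigenvalue (Matrix.toLin' (lazyP G))).subset ?_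
    rintro q ⟨_, g, hg, hg2⟩
    refine Module.End.hasEigenvalue_of_hasEigenvector (x := g) ⟨?_, hg⟩
    rw [Module.End.mem_eigenspace_iff]
    simpa using hg2
  have hmem : r ∈ s := ⟨hr, f, hf, h⟩
  have hle : r ≤ sSup s := le_csSup hfin.bddAbove hmem
  obtain ⟨h1, g, hg, hg2⟩ : sSup s ∈ s := Set.Nonempty.csSup_mem ⟨r, hmem⟩ hfin
  have hlt : sSup s < 1 := lt_of_le_of_ne (lrw_eig_bounds G hd _ g hg hg2).2 h1
  have : 1 / (1 - r) ≤ 1 / (1 - sSup s) :=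
    one_div_le_one_div_of_le (by linarith) (by linarith)
  exact this.trans (Nat.le_ceil _)

lemma lrw_scalar (r : ℝ) (h0 : 0 ≤ r) (h1 : r < 1) (T t : ℕ) (hT : 1 / (1 - r) ≤ T) :
    (∑ i ∈ Finset.range t, r ^ i) ^ 2 ≤
      ((T : ℝ) / (1 - 1 / Real.exp 1) ^ 2) * ∑ i ∈ Finset.range T, r ^ i := by
  have hp : 0 < 1 - r := by linarith
  set c := 1 - 1 / Real.exp 1 with hc
  have hc1 : c ≤ 1 := by
    have : 0 < 1 / Real.exp 1 := by positivity
    linarith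
  have hc0 : 0 < c := by
    have : 1 / Real.exp 1 < 1 := by
      rw [div_lt_one (Real.exp_pos _)]
      exact Real.one_lt_exp_iff.2 one_pos
    linarith
  have gs : ∀ n : ℕ, ∑ i ∈ Finset.range n, r ^ i = (1 - r ^ n) / (1 - r) := by
    intro n
    rw [eq_div_iff hp.ne']
    exact geom_sum_mul_neg r n
  have hA : ∑ i ∈ Finset.range t, r ^ i ≤ 1 / (1 - r) := by
    rw [gs]
    gcongr
    linarith [pow_nonneg h0 t]
  have hA0 : 0 ≤ ∑ i ∈ Finset.range t, r ^ i := Finset.sum_nonneg fun i _ => pow_nonneg h0 i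
  have hrT : r ^ T ≤ 1 / Real.exp 1 := by
    have a : r ≤ Real.exp (-(1 - r)) := by
      have := Real.add_one_le_exp (-(1 - r)); linarith
    calc r ^ T ≤ (Real.exp (-(1 - r))) ^ T := by gcongr
      _ = Real.exp (T * (-(1 - r))) := by rw [← Real.exp_nat_mul]
      _ ≤ Real.exp (-1) := by
        apply Real.exp_le_exp.2
        rw [div_le_iff₀ hp] at hT
        linarith
      _ = _ := by rw [Real.exp_neg, one_div]
  have hB : c / (1 - r) ≤ ∑ i ∈ Finset.range T, r ^ i := by
    rw [gs]
    gcongr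
    linarith
  have hT0 : (0:ℝ) ≤ T := Nat.cast_nonneg _
  calc (∑ i ∈ Finset.range t, r ^ i) ^ 2 ≤ (1 / (1 - r)) ^ 2 := by gcongr
    _ = (1 / (1 - r)) * (1 / (1 - r)) := by ring
    _ ≤ T * (1 / (1 - r)) := by gcongr
    _ ≤ T * (1 / (1 - r) / c) := by
        refine mul_le_mul_of_nonneg_left ?_ hT0
        rw [le_div_iff₀ hc0]
        exact mul_le_of_le_one_right (by positivity) hc1
    _ = (T / c ^ 2) * (c / (1 - r)) := by field_simp
    _ ≤ _ := by gcongr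

lemma lrw_spectral {V : Type} [Fintype V] (S : Matrix V V ℝ) (hS : S.IsHermitian) :
    ∃ (l : V → ℝ) (b : V → V → ℝ),
      (∀ a, S.mulVec (b a) = l a • b a) ∧
      (∀ a, b a ≠ 0) ∧
      (∀ u v, ∑ a, b a u * b a v = if u = v then 1 else 0) := by
  refine ⟨hS.eigenvalues, fun a => hS.eigenvectorBasis a, fun a => hS.mulVec_eigenvectorBasis a,
    fun a h => ?_, fun u v => ?_⟩
  · apply hS.eigenvectorBasis.orthonormal.ne_zero a
    ext v
    exact congrFun h v
  · have h := (Matrix.mem_unitaryGroup_iff.1 hS.eigenvectorUnitary.2)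
    have h2 := congrFun (congrFun h u) v
    rw [Matrix.mul_apply, Matrix.one_apply] at h2
    rw [← h2]
    refine Finset.sum_congr rfl fun a _ => ?_
    simp [Matrix.star_apply, Matrix.IsHermitian.eigenvectorUnitary_apply]

/-- Spectral representation of return probabilities. -/
lemma lrw_rep {V : Type} [Fintype V] [Nontrivial V] (G : SimpleGraph V) (hG : G.Connected)
    (hd : ∀ u, (0 : ℝ) < G.degree u) (x : V) :
    ∃ (l w : V → ℝ), (∀ a, 0 ≤ w a) ∧
      (∀ k : ℕ, (lazyP G ^ k) x x = ∑ a, w a * l a ^ k) ∧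
      (∀ a, 0 ≤ l a) ∧
      (∀ a, l a ≠ 1 → l a < 1 ∧ 1 / (1 - l a) ≤ relTime (lazyP G)) ∧
      (∑ a, (if l a = 1 then w a else 0) = statDist G x) := by
  set d : V → ℝ := fun u => Real.sqrt (G.degree u) with hdd
  have d0 : ∀ u, 0 < d u := fun u => Real.sqrt_pos.2 (hd u)
  have d2 : ∀ u, d u * d u = G.degree u := fun u => Real.mul_self_sqrt (hd u).le
  set S : Matrix V V ℝ := fun u v => d u * lazyP G u v / d v with hSd
  have hSH : S.IsHermitian := by
    ext u v
    change d v * lazyP G v u / d u = d u * lazyP G u v / d v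
    by_cases h1 : u = v
    · subst h1; rfl
    · have hu := d0 u
      have hv := d0 v
      by_cases h2 : G.Adj u v
      · simp only [lazyP, h1, Ne.symm h1, if_false, h2, h2.symm, if_true, ← d2]
        field_simp
      · have h3 : ¬ G.Adj v u := fun h => h2 h.symm
        simp [lazyP, h1, Ne.symm h1, h2, h3]
  have hpow : ∀ k u v, (S ^ k) u v = d u * (lazyP G ^ k) u v / d v := by
    intro k
    induction k with
    | zero =>
      intro u v
      have := (d0 u).ne'
      by_cases h : u = v
      · subst h; simp [this]
      · simp [Matrix.one_apply, h]
    | succ k ih =>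
      intro u v
      rw [pow_succ, pow_succ, Matrix.mul_apply, Matrix.mul_apply, Finset.mul_sum, Finset.sum_div]
      refine Finset.sum_congr rfl fun z _ => ?_
      rw [ih]
      have := (d0 z).ne'
      simp only [hSd]
      field_simp
  obtain ⟨l, b, hb, hbn, hcol⟩ := lrw_spectral S hSH
  -- eigenvectors of the walk
  have hPe : ∀ a, (lazyP G).mulVec (fun v => b a v / d v) = l a • (fun v => b a v / d v) := by
    intro a
    funext u
    have h := congrFun (hb a) u
    simp only [Matrix.mulVec, dotProduct, Pi.smul_apply, smul_eq_mul, hSd] at h ⊢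
    have hu := (d0 u).ne'
    rw [← mul_div_assoc, ← h, Finset.sum_div]
    refine Finset.sum_congr rfl fun z _ => ?_
    field_simp
  have hPn : ∀ a, (fun v => b a v / d v) ≠ 0 := by
    intro a h
    apply hbn a
    funext v
    have := congrFun h v
    simpa [(d0 v).ne'] using this
  have hbp : ∀ k a, (S ^ k).mulVec (b a) = l a ^ k • b a := by
    intro k a
    induction k with
    | zero => simp
    | succ k ih => rw [pow_succ', ← Matrix.mulVec_mulVec, ih, Matrix.mulVec_smul, hb, smul_smul, pow_succ]
  refine ⟨l, fun a => b a x * b a x, fun a => mul_self_nonneg _, ?_, ?_, ?_, ?_⟩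
  · intro k
    have h1 : (lazyP G ^ k) x x = (S ^ k) x x := by
      rw [hpow]
      have := (d0 x).ne'
      field_simp
    rw [h1]
    calc (S ^ k) x x = ∑ v, (S ^ k) x v * ∑ a, b a v * b a x := by simp [hcol]
      _ = ∑ a, (∑ v, (S ^ k) x v * b a v) * b a x := by
        simp only [Finset.mul_sum, Finset.sum_mul]
        rw [Finset.sum_comm]
        simp only [mul_assoc]
      _ = _ := by
        refine Finset.sum_congr rfl fun a _ => ?_
        have := congrFun (hbp k a) x
        simp only [Matrix.mulVec, dotProduct, Pi.smul_apply, smul_eq_mul] at this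
        rw [this]
        ring
  · exact fun a => (lrw_eig_bounds G hd _ _ (hPn a) (hPe a)).1
  · exact fun a ha => ⟨lt_of_le_of_ne (lrw_eig_bounds G hd _ _ (hPn a) (hPe a)).2 ha,
      lrw_second G hd _ ha _ (hPn a) (hPe a)⟩
  · -- the eigenspace of one
    have hSsym : ∀ u v, S u v = S v u := fun u v => by
      have := hSH.apply u v
      simpa using this.symm
    have hSd1 : ∀ u, ∑ v, S u v * d v = d u := by
      intro u
      have h := congrFun (lrw_one G hd) u
      simp only [Matrix.mulVec, dotProduct, mul_one] at h
      calc ∑ v, S u v * d v = ∑ v, d u * lazyP G u v := by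
            refine Finset.sum_congr rfl fun v _ => ?_
            have := (d0 v).ne'
            simp only [hSd]
            field_simp
        _ = d u := by rw [← Finset.mul_sum, h, mul_one]
    have hort : ∀ a, l a ≠ 1 → ∑ v, b a v * d v = 0 := by
      intro a ha
      have e : l a * ∑ v, b a v * d v = ∑ v, b a v * d v := by
        calc l a * ∑ v, b a v * d v = ∑ v, (∑ z, S v z * b a z) * d v := by
              rw [Finset.mul_sum]
              refine Finset.sum_congr rfl fun v _ => ?_
              have := congrFun (hb a) v
              simp only [Matrix.mulVec, dotProduct, Pi.smul_apply, smul_eq_mul] at this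
              rw [this]; ring
          _ = ∑ z, b a z * ∑ v, S z v * d v := by
              simp only [Finset.mul_sum, Finset.sum_mul]
              rw [Finset.sum_comm]
              refine Finset.sum_congr rfl fun z _ => Finset.sum_congr rfl fun v _ => ?_
              rw [hSsym v z]; ring
          _ = _ := by simp only [hSd1]
      have : (l a - 1) * ∑ v, b a v * d v = 0 := by linarith
      exact (mul_eq_zero.1 this).resolve_left (sub_ne_zero.2 ha)
    have hN : ∑ v, d v * d v = 2 * (numEdges G : ℝ) := by
      simp only [d2]
      have := G.sum_degrees_eq_twice_card_edges
      unfold numEdges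
      exact_mod_cast this
    have hNpos : 0 < ∑ v, d v * d v :=
      Finset.sum_pos (fun v _ => mul_pos (d0 v) (d0 v)) ⟨x, Finset.mem_univ x⟩
    have hconst : ∀ a, l a = 1 → ∀ v, b a v = b a x / d x * d v := by
      intro a ha v
      have h := hPe a
      rw [ha, one_smul] at h
      have := lrw_harm G hG hd _ h x v
      rw [this]
      have := (d0 v).ne'
      field_simp
    have key : d x = ∑ a, b a x * ∑ v, b a v * d v := by
      calc d x = ∑ v, (∑ a, b a x * b a v) * d v := by simp [hcol]
        _ = _ := by
          simp only [Finset.mul_sum, Finset.sum_mul]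
          rw [Finset.sum_comm]
          simp only [mul_assoc]
    have key2 : d x * d x = (∑ a, if l a = 1 then b a x * b a x else 0) * ∑ v, d v * d v := by
      nth_rewrite 1 [key]
      rw [Finset.sum_mul, Finset.sum_mul]
      refine Finset.sum_congr rfl fun a _ => ?_
      by_cases ha : l a = 1
      · have : ∑ v, b a v * d v = b a x / d x * ∑ v, d v * d v := by
          rw [Finset.mul_sum]
          refine Finset.sum_congr rfl fun v _ => ?_
          rw [hconst a ha v]; ring
        rw [this, if_pos ha]
        have := (d0 x).ne'
        field_simp
      · rw [hort a ha, if_neg ha]; ring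
    unfold statDist
    rw [← hN, eq_div_iff hNpos.ne', ← key2, d2]

/-- For a finite connected graph `G`, every vertex `x` and every `t ≥ 1`:
`∑_{i,j=0}^{t-1} (P^{i+j}(x,x)/π(x) - 1) ≤ (t_rel/(1-1/e)²) g_{t_rel}(x,x)/π(x)`. -/
theorem centered_return_probabilities_sum_bound
    {V : Type} [Fintype V] [Nontrivial V] (G : SimpleGraph V) (hG : G.Connected)
    (x : V) (t : ℕ) (ht : 1 ≤ t) :
    ∑ i ∈ Finset.range t, ∑ j ∈ Finset.range t,
        ((lazyP G ^ (i + j)) x x / statDist G x - 1) ≤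
      ((relTime (lazyP G) : ℝ) / (1 - 1 / Real.exp 1) ^ 2) *
        (green (lazyP G) (relTime (lazyP G)) x x / statDist G x) := by
  have hd : ∀ u, (0 : ℝ) < G.degree u := fun u => by
    exact_mod_cast hG.preconnected.degree_pos_of_nontrivial u
  obtain ⟨l, w, hw, hrep, hl0, hl1, hpi⟩ := lrw_rep G hG hd x
  have hpos : 0 < statDist G x := by
    have h := G.sum_degrees_eq_twice_card_edges
    have h2 : 0 < ∑ v, (G.degree v : ℝ) :=
      Finset.sum_pos (fun v _ => hd v) ⟨x, Finset.mem_univ x⟩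
    have h3 : ∑ v, (G.degree v : ℝ) = 2 * (numEdges G : ℝ) := by
      unfold numEdges
      exact_mod_cast h
    unfold statDist
    rw [← h3]
    exact div_pos (hd x) h2
  set T := relTime (lazyP G) with hT
  have hterm : ∀ k : ℕ, (lazyP G ^ k) x x / statDist G x - 1 =
      (∑ a, (if l a = 1 then 0 else w a * l a ^ k)) / statDist G x := by
    intro k
    rw [div_sub_one hpos.ne', hrep]
    congr 1
    rw [← hpi, ← Finset.sum_sub_distrib]
    refine Finset.sum_congr rfl fun a _ => ?_
    by_cases ha : l a = 1 <;> simp [ha]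
  simp only [hterm]
  simp only [← Finset.sum_div]
  rw [← mul_div_assoc]
  refine div_le_div_of_nonneg_right ?_ hpos.le
  unfold green
  simp only [hrep]
  have e1 : ∑ i ∈ Finset.range t, ∑ j ∈ Finset.range t,
      ∑ a, (if l a = 1 then 0 else w a * l a ^ (i + j)) =
      ∑ a, (if l a = 1 then 0 else w a * (∑ i ∈ Finset.range t, l a ^ i) ^ 2) := by
    have : ∀ i ∈ Finset.range t, ∑ j ∈ Finset.range t,
      ∑ a, (if l a = 1 then 0 else w a * l a ^ (i + j)) =
      ∑ a, ∑ j ∈ Finset.range t, (if l a = 1 then 0 else w a * l a ^ (i + j)) :=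
      fun i _ => Finset.sum_comm
    rw [Finset.sum_congr rfl this, Finset.sum_comm]
    refine Finset.sum_congr rfl fun a _ => ?_
    by_cases ha : l a = 1
    · simp [ha]
    · simp only [ha, if_false]
      rw [sq, Finset.sum_mul_sum]
      simp only [Finset.mul_sum, pow_add]
  rw [e1, Finset.sum_comm, Finset.mul_sum]
  refine Finset.sum_le_sum fun a _ => ?_
  rw [← Finset.mul_sum]
  by_cases ha : l a = 1
  · rw [if_pos ha]
    have := hw a
    have h2 : 0 ≤ ∑ i ∈ Finset.range T, l a ^ i :=
      Finset.sum_nonneg fun i _ => pow_nonneg (hl0 a) i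
    positivity
  · rw [if_neg ha]
    have h := lrw_scalar (l a) (hl0 a) (hl1 a ha).1 T t (hl1 a ha).2
    calc _ ≤ w a * (((T : ℝ) / (1 - 1 / Real.exp 1) ^ 2) * ∑ i ∈ Finset.range T, l a ^ i) :=
          mul_le_mul_of_nonneg_left h (hw a)
      _ = _ := by ring
end

section
/- There is a universal constant c > 0 such that for every finite connected graph G=(V,E) with m edges, minimum degree d and relaxation time t_rel, for all vertices x,y, and for every integer t ≥ c·t_rel^{3/4}·sqrt(m/d), two independent lazy random walks of length t started from x and y respectively intersect with probability at least 1/8, i.e. P_{x,y}(𝓘_t > 0) ≥ 1/8. -/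
open Finset
open scoped Classical BigOperators

noncomputable def dirE {V : Type} [Fintype V] (G : SimpleGraph V) (f : V → ℝ) : ℝ :=
  (1 / 4) * ∑ u, ∑ v, if G.Adj u v then (f u - f v) ^ 2 else 0

noncomputable def nrm {V : Type} [Fintype V] (G : SimpleGraph V) (f : V → ℝ) : ℝ :=
  ∑ u, (G.degree u : ℝ) * f u ^ 2

lemma dirE_nonneg {V : Type} [Fintype V] (G : SimpleGraph V) (f : V → ℝ) : 0 ≤ dirE G f := by
  unfold dirE
  refine mul_nonneg (by norm_num) (Finset.sum_nonneg fun u _ => Finset.sum_nonneg fun v _ => ?_)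
  split_ifs <;> positivity

lemma nrm_nonneg {V : Type} [Fintype V] (G : SimpleGraph V) (f : V → ℝ) : 0 ≤ nrm G f := by
  unfold nrm
  exact Finset.sum_nonneg fun u _ => by positivity

lemma dirE_neg {V : Type} [Fintype V] (G : SimpleGraph V) (f : V → ℝ) :
    dirE G (fun v => - f v) = dirE G f := by
  unfold dirE
  congr 1
  refine Finset.sum_congr rfl fun u _ => Finset.sum_congr rfl fun v _ => ?_
  split_ifs
  · ring
  · rfl

lemma nrm_neg {V : Type} [Fintype V] (G : SimpleGraph V) (f : V → ℝ) :
    nrm G (fun v => - f v) = nrm G f := by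
  unfold nrm
  exact Finset.sum_congr rfl fun u _ => by ring

/-- energy lower bound along an injective family of oriented edges -/
lemma energy_family {V : Type} [Fintype V] (G : SimpleGraph V) (f : V → ℝ)
    {ι : Type} (s : Finset ι) (a b : ι → V) (hadj : ∀ i ∈ s, G.Adj (a i) (b i))
    (hinj : ∀ i ∈ s, ∀ j ∈ s, a i = a j → b i = b j → i = j) :
    ∑ i ∈ s, (f (a i) - f (b i)) ^ 2 ≤ 4 * dirE G f := by
  unfold dirE
  have h1 : ∑ i ∈ s, (f (a i) - f (b i)) ^ 2 =
      ∑ z ∈ s.image (fun i => (a i, b i)), if G.Adj z.1 z.2 then (f z.1 - f z.2) ^ 2 else 0 := by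
    rw [Finset.sum_image]
    · exact Finset.sum_congr rfl fun i hi => by simp [hadj i hi]
    · intro i hi j hj hij
      simp only [Prod.mk.injEq] at hij
      exact hinj i hi j hj hij.1 hij.2
  have h2 : ∑ z ∈ s.image (fun i => (a i, b i)),
      (if G.Adj z.1 z.2 then (f z.1 - f z.2) ^ 2 else 0) ≤
      ∑ z : V × V, if G.Adj z.1 z.2 then (f z.1 - f z.2) ^ 2 else 0 := by
    refine Finset.sum_le_sum_of_subset_of_nonneg (Finset.subset_univ _) fun z _ _ => ?_
    split_ifs <;> positivity
  rw [Fintype.sum_prod_type] at h2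
  linarith

lemma exists_geod {V : Type} [Fintype V] (G : SimpleGraph V) (hG : G.Connected)
    (f : V → ℝ) (x w : V) (a : ℝ) (hw : f w < a) (hx : a ≤ f x) :
    ∃ (k : ℕ) (p : ℕ → V), 1 ≤ k ∧ p 0 = x ∧ f (p k) < a ∧
      (∀ i < k, G.Adj (p i) (p (i + 1))) ∧ (∀ i ≤ k, G.dist x (p i) = i) ∧
      (∀ v, G.dist x v < k → a ≤ f v) := by
  obtain ⟨z, hz, hmin⟩ := Finset.exists_min_image (Finset.univ.filter fun v => f v < a)
    (fun v => G.dist x v) ⟨w, by simp [hw]⟩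
  simp only [Finset.mem_filter, Finset.mem_univ, true_and] at hz hmin
  obtain ⟨p, hp⟩ := hG.exists_walk_length_eq_dist x z
  refine ⟨G.dist x z, p.getVert, ?_, by simp, ?_, ?_, ?_, ?_⟩
  · have : x ≠ z := by rintro rfl; linarith
    exact hG.pos_dist_of_ne this
  · rw [← hp]; simpa using hz
  · intro i hi
    exact p.adj_getVert_succ (by omega)
  · intro i hi
    have h1 : G.dist x (p.getVert i) ≤ i := by
      have := SimpleGraph.dist_le (p.take i)
      rw [SimpleGraph.Walk.take_length] at this
      exact this.trans (min_le_left _ _)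
    have h2 : G.dist (p.getVert i) z ≤ p.length - i := by
      have := SimpleGraph.dist_le (p.drop i)
      rwa [SimpleGraph.Walk.drop_length] at this
    have h3 : G.dist x z ≤ _ := hG.dist_triangle (u := x) (v := p.getVert i) (w := z)
    omega
  · intro v hv
    by_contra hlt
    push Not at hlt
    exact absurd (hmin v hlt) (by omega)

lemma adj_dist {V : Type} (G : SimpleGraph V) (hG : G.Connected) {x u v : V} (h : G.Adj u v) :
    G.dist x v ≤ G.dist x u + 1 := by
  have h3 : G.dist x v ≤ _ := hG.dist_triangle (u := x) (v := u) (w := v)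
  rw [SimpleGraph.dist_eq_one_iff_adj.2 h] at h3
  exact h3

lemma nash {V : Type} [Fintype V] (G : SimpleGraph V) (hG : G.Connected)
    (f : V → ℝ) (x w : V) (hw : f w ≤ 0) (hx : 0 < f x) :
    (G.minDegree : ℝ) ^ 2 * (f x) ^ 4 ≤ 384 * dirE G f * nrm G f := by
  set A := f x with hA
  set d : ℝ := (G.minDegree : ℝ) with hd
  have hdeg : ∀ v, d ≤ (G.degree v : ℝ) := fun v => by
    rw [hd]; exact_mod_cast G.minDegree_le_degree v
  have hd0 : 0 ≤ d := by positivity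
  obtain ⟨k, p, hk, hp0, hpk, hadj, hdist, hW⟩ :=
    exists_geod G hG f x w (A / 2) (by linarith) (by linarith)
  have hE := dirE_nonneg G f
  rcases eq_or_lt_of_le hk with hk1 | hk2
  · -- k = 1
    subst hk1
    set S1 := (G.neighborFinset x).filter (fun v => A / 2 ≤ f v) with hS1
    set S2 := (G.neighborFinset x).filter (fun v => ¬ A / 2 ≤ f v) with hS2
    have hcard : S1.card + S2.card = G.degree x := by
      rw [hS1, hS2, Finset.card_filter_add_card_filter_not, SimpleGraph.card_neighborFinset_eq_degree]
    have hs2 : 1 ≤ S2.card := by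
      rw [Nat.one_le_iff_ne_zero, Finset.card_ne_zero]
      refine ⟨p 1, ?_⟩
      have := hadj 0 (by norm_num)
      rw [hp0] at this
      simp only [hS2, Finset.mem_filter, SimpleGraph.mem_neighborFinset]
      exact ⟨this, by linarith⟩
    have hE2 : (S2.card : ℝ) * (A ^ 2 / 4) ≤ 4 * dirE G f := by
      refine le_trans ?_ (energy_family G f S2 (fun _ => x) (fun v => v) ?_ ?_)
      · rw [← nsmul_eq_mul]
        refine Finset.card_nsmul_le_sum _ _ _ fun v hv => ?_
        simp only [hS2, Finset.mem_filter] at hv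
        rw [← hA]
        nlinarith [hv.2]
      · intro v hv
        simp only [hS2, Finset.mem_filter, SimpleGraph.mem_neighborFinset] at hv
        exact hv.1
      · intro i _ j _ _ h; exact h
    have hN : (1 + (S1.card : ℝ)) * (d * (A ^ 2 / 4)) ≤ nrm G f := by
      have hx1 : x ∉ S1 := by simp [hS1]
      have : ((insert x S1).card : ℝ) = 1 + S1.card := by
        rw [Finset.card_insert_of_notMem hx1]; push_cast; ring
      rw [← this, ← nsmul_eq_mul]
      refine (Finset.card_nsmul_le_sum (insert x S1) (fun v => (G.degree v : ℝ) * f v ^ 2) _ ?_).trans ?_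
      · intro v hv
        have hv2 : A / 2 ≤ f v := by
          rw [Finset.mem_insert] at hv
          rcases hv with rfl | hv
          · linarith
          · exact (Finset.mem_filter.1 hv).2
        exact mul_le_mul (hdeg v) (by nlinarith) (by positivity) (by positivity)
      · exact Finset.sum_le_sum_of_subset_of_nonneg (Finset.subset_univ _) fun _ _ _ => by positivity
    have h1 : (1 : ℝ) ≤ S2.card := by exact_mod_cast hs2
    have h0 : (0 : ℝ) ≤ S1.card := by positivity
    have hc : d ≤ (S1.card : ℝ) + S2.card := by
      refine (hdeg x).trans (le_of_eq ?_)
      rw [← hcard]; push_cast; ring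
    have hmul := mul_le_mul hE2 hN (by positivity) (by positivity)
    have hcc : d ≤ (S2.card : ℝ) * (1 + S1.card) := by nlinarith
    have : d * (d * A ^ 4 / 16) ≤ (S2.card : ℝ) * (1 + S1.card) * (d * A ^ 4 / 16) :=
      mul_le_mul_of_nonneg_right hcc (by positivity)
    have hN0 := mul_nonneg hE (nrm_nonneg G f)
    nlinarith
  · -- k ≥ 2
    have hkR : (2 : ℝ) ≤ k := by exact_mod_cast hk2
    have hE2 : A ^ 2 / 4 ≤ k * (4 * dirE G f) := by
      have h1 := energy_family G f (Finset.range k) (fun i => p i) (fun i => p (i + 1))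
        (fun i hi => hadj i (Finset.mem_range.1 hi)) (by
          intro i hi j hj hij _
          have h1 := hdist i (Finset.mem_range.1 hi).le
          have h2 := hdist j (Finset.mem_range.1 hj).le
          rw [hij] at h1
          omega)
      have h2 : ∑ i ∈ Finset.range k, (f (p i) - f (p (i + 1))) = A - f (p k) := by
        rw [Finset.sum_range_sub' (fun i => f (p i)), hp0]
      have h3 := sq_sum_le_card_mul_sum_sq (s := Finset.range k)
        (f := fun i => f (p i) - f (p (i + 1)))
      rw [h2, Finset.card_range] at h3
      have h4 : A ^ 2 / 4 ≤ (A - f (p k)) ^ 2 := by nlinarith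
      calc A ^ 2 / 4 ≤ _ := h4
        _ ≤ _ := h3
        _ ≤ _ := mul_le_mul_of_nonneg_left h1 (by positivity)
    have hN : ((k : ℝ) - 1) * (d * (d * (A ^ 2 / 4))) ≤ 3 * nrm G f := by
      have h1 : ∑ i ∈ Finset.range (k - 1), ∑ u ∈ G.neighborFinset (p i),
          (G.degree u : ℝ) * f u ^ 2 ≤ 3 * nrm G f := by
        have : ∀ i, ∑ u ∈ G.neighborFinset (p i), (G.degree u : ℝ) * f u ^ 2 =
            ∑ u, if G.Adj (p i) u then (G.degree u : ℝ) * f u ^ 2 else 0 := by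
          intro i
          rw [← Finset.sum_filter]
          congr 1
          ext u; simp
        simp_rw [this]
        rw [Finset.sum_comm]
        unfold nrm
        rw [Finset.mul_sum]
        refine Finset.sum_le_sum fun u _ => ?_
        rw [← Finset.sum_filter, Finset.sum_const, nsmul_eq_mul]
        refine mul_le_mul_of_nonneg_right ?_ (by positivity)
        have hsub : (Finset.range (k - 1)).filter (fun i => G.Adj (p i) u) ⊆
            Finset.Icc (G.dist x u - 1) (G.dist x u + 1) := by
          intro i hi
          rw [Finset.mem_filter, Finset.mem_range] at hi
          have h1 := hdist i (by omega)
          have h2 := adj_dist G hG (x := x) hi.2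
          have h3 := adj_dist G hG (x := x) hi.2.symm
          rw [Finset.mem_Icc]; omega
        have := Finset.card_le_card hsub
        rw [Nat.card_Icc] at this
        have h3 : ((Finset.range (k - 1)).filter (fun i => G.Adj (p i) u)).card ≤ 3 := by omega
        exact_mod_cast h3
      refine le_trans ?_ h1
      have h2 : ((k : ℝ) - 1) = ((Finset.range (k - 1)).card : ℝ) := by
        rw [Finset.card_range, Nat.cast_sub (by omega)]; simp
      rw [h2, ← nsmul_eq_mul]
      refine Finset.card_nsmul_le_sum _ _ _ fun i hi => ?_
      rw [Finset.mem_range] at hi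
      have h4 : (G.degree (p i) : ℝ) * (d * (A ^ 2 / 4)) ≤
          ∑ u ∈ G.neighborFinset (p i), (G.degree u : ℝ) * f u ^ 2 := by
        rw [← SimpleGraph.card_neighborFinset_eq_degree, ← nsmul_eq_mul]
        refine Finset.card_nsmul_le_sum _ _ _ fun v hv => ?_
        rw [SimpleGraph.mem_neighborFinset] at hv
        have h5 := adj_dist G hG (x := x) hv
        have h6 := hdist i (by omega)
        have h7 := hW v (by omega)
        exact mul_le_mul (hdeg v) (by nlinarith) (by positivity) (by positivity)
      exact (mul_le_mul_of_nonneg_right (hdeg _) (by positivity)).trans h4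
    have hN0 := mul_nonneg hE (nrm_nonneg G f)
    have hN' : (k : ℝ) * (d * (d * (A ^ 2 / 4))) ≤ 6 * nrm G f := by
      have : 0 ≤ d * (d * (A ^ 2 / 4)) := by positivity
      nlinarith
    have hmul := mul_le_mul hE2 hN' (by positivity) (by positivity)
    have : (k : ℝ) * (d ^ 2 * A ^ 4) ≤ k * (384 * dirE G f * nrm G f) := by nlinarith
    exact le_of_mul_le_mul_left this (by linarith)

lemma deg_pos' {V : Type} [Fintype V] [Nontrivial V] (G : SimpleGraph V) (hG : G.Connected) (u : V) :
    0 < (G.degree u : ℝ) := by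
  exact_mod_cast hG.preconnected.degree_pos_of_nontrivial u

lemma degP {V : Type} [Fintype V] [Nontrivial V] (G : SimpleGraph V) (hG : G.Connected) (u v : V) :
    (G.degree u : ℝ) * lazyP G u v =
      if u = v then (G.degree u : ℝ) / 2 else if G.Adj u v then 1 / 2 else 0 := by
  have := deg_pos' G hG u
  unfold lazyP
  split_ifs
  · ring
  · field_simp
  · ring

lemma degP_symm {V : Type} [Fintype V] [Nontrivial V] (G : SimpleGraph V) (hG : G.Connected) (u v : V) :
    (G.degree u : ℝ) * lazyP G u v = (G.degree v : ℝ) * lazyP G v u := by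
  rw [degP G hG, degP G hG]
  by_cases h : u = v
  · subst h; simp
  · simp [h, Ne.symm h, G.adj_comm]

lemma lazyP_nonneg {V : Type} [Fintype V] (G : SimpleGraph V) (u v : V) : 0 ≤ lazyP G u v := by
  unfold lazyP
  split_ifs <;> positivity

lemma lazyP_row {V : Type} [Fintype V] [Nontrivial V] (G : SimpleGraph V) (hG : G.Connected) (u : V) :
    ∑ v, lazyP G u v = 1 := by
  have hu := deg_pos' G hG u
  have h1 : ∀ v, lazyP G u v = (if u = v then 1 / 2 else 0) +
      (if G.Adj u v then 1 / (2 * (G.degree u : ℝ)) else 0) := by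
    intro v
    unfold lazyP
    by_cases h : u = v
    · subst h; simp
    · simp [h]
  simp_rw [h1]
  rw [Finset.sum_add_distrib, ← Finset.sum_filter (fun v => G.Adj u v), Finset.sum_const,
    ← SimpleGraph.neighborFinset_eq_filter, SimpleGraph.card_neighborFinset_eq_degree]
  simp only [Finset.sum_ite_eq, Finset.mem_univ, if_true, nsmul_eq_mul]
  field_simp
  norm_num

lemma dirichlet {V : Type} [Fintype V] [Nontrivial V] (G : SimpleGraph V) (hG : G.Connected)
    (f : V → ℝ) :
    ∑ u, (G.degree u : ℝ) * f u * (f u - (lazyP G).mulVec f u) = dirE G f := by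
  have h1 : ∀ u, (G.degree u : ℝ) * f u * (f u - (lazyP G).mulVec f u) =
      ∑ v, (G.degree u : ℝ) * lazyP G u v * (f u * f u - f u * f v) := by
    intro u
    have : f u = ∑ v, lazyP G u v * f u := by rw [← Finset.sum_mul, lazyP_row G hG, one_mul]
    simp only [Matrix.mulVec, dotProduct]
    conv_lhs => rw [show f u - ∑ v, lazyP G u v * f v = ∑ v, lazyP G u v * (f u - f v) by
      simp_rw [mul_sub]; rw [Finset.sum_sub_distrib, ← this]]
    rw [Finset.mul_sum]
    exact Finset.sum_congr rfl fun v _ => by ring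
  have h2 : ∑ u, ∑ v, (G.degree u : ℝ) * lazyP G u v * (f u * f u - f u * f v) =
      ∑ u, ∑ v, (G.degree u : ℝ) * lazyP G u v * (f v * f v - f u * f v) := by
    rw [Finset.sum_comm]
    refine Finset.sum_congr rfl fun u _ => Finset.sum_congr rfl fun v _ => ?_
    rw [degP_symm G hG]; ring
  have h3 : ∑ u, ∑ v, (G.degree u : ℝ) * lazyP G u v * (f u * f u - f u * f v) +
      ∑ u, ∑ v, (G.degree u : ℝ) * lazyP G u v * (f v * f v - f u * f v) =
      2 * dirE G f := by
    unfold dirE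
    rw [← Finset.sum_add_distrib, ← mul_assoc, Finset.mul_sum]
    refine Finset.sum_congr rfl fun u _ => ?_
    rw [← Finset.sum_add_distrib, Finset.mul_sum]
    refine Finset.sum_congr rfl fun v _ => ?_
    rw [degP G hG]
    by_cases h : u = v
    · subst h; simp
    · by_cases h' : G.Adj u v <;> simp [h, h'] ; ring
  rw [Finset.sum_congr rfl fun u _ => h1 u]
  linarith

lemma dirE_zero {V : Type} [Fintype V] (G : SimpleGraph V) (hG : G.Connected)
    (f : V → ℝ) (h : dirE G f = 0) (u v : V) : f u = f v := by
  have hadj : ∀ a b, G.Adj a b → f a = f b := by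
    intro a b hab
    have := energy_family G f (Finset.univ : Finset Unit) (fun _ => a) (fun _ => b)
      (fun _ _ => hab) (fun _ _ _ _ _ _ => rfl)
    rw [h] at this
    simp at this
    nlinarith [sq_nonneg (f a - f b)]
  obtain ⟨p⟩ := hG.preconnected u v
  induction p with
  | nil => rfl
  | cons hh _ ih => exact (hadj _ _ hh).trans ih

lemma eig_dir {V : Type} [Fintype V] [Nontrivial V] (G : SimpleGraph V) (hG : G.Connected)
    (f : V → ℝ) (r : ℝ) (h : (lazyP G).mulVec f = r • f) : dirE G f = (1 - r) * nrm G f := by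
  rw [← dirichlet G hG, h]
  unfold nrm
  rw [Finset.mul_sum]
  refine Finset.sum_congr rfl fun u _ => ?_
  simp only [Pi.smul_apply, smul_eq_mul]
  ring

lemma nrm_pos {V : Type} [Fintype V] [Nontrivial V] (G : SimpleGraph V) (hG : G.Connected)
    (f : V → ℝ) (h : f ≠ 0) : 0 < nrm G f := by
  obtain ⟨u, hu⟩ := Function.ne_iff.1 h
  unfold nrm
  refine Finset.sum_pos' (fun v _ => by positivity) ⟨u, Finset.mem_univ _, ?_⟩
  have := deg_pos' G hG u
  have hu' : f u ≠ 0 := hu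
  positivity

lemma eigset_finite {V : Type} [Fintype V] (G : SimpleGraph V) :
    {r : ℝ | r ≠ 1 ∧ ∃ f : V → ℝ, f ≠ 0 ∧ (lazyP G).mulVec f = r • f}.Finite := by
  refine (Module.End.finite_hasEigenvalue (Matrix.toLin' (lazyP G))).subset ?_
  rintro r ⟨_, f, hf, h⟩
  exact Module.End.hasEigenvalue_of_hasEigenvector
    (Module.End.hasEigenvector_iff.2 ⟨Module.End.mem_eigenspace_iff.2 (by simpa using h), hf⟩)

lemma secondEig_lt {V : Type} [Fintype V] [Nontrivial V] (G : SimpleGraph V) (hG : G.Connected) :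
    secondEig (lazyP G) < 1 := by
  unfold secondEig
  rcases Set.eq_empty_or_nonempty
    {r : ℝ | r ≠ 1 ∧ ∃ f : V → ℝ, f ≠ 0 ∧ (lazyP G).mulVec f = r • f} with h | h
  · rw [h]; simp
  · obtain ⟨h1, f, hf, h2⟩ := h.csSup_mem (eigset_finite G)
    refine lt_of_le_of_ne ?_ h1
    have h3 := eig_dir G hG f _ h2
    have h4 := dirE_nonneg G f
    have h5 := nrm_pos G hG f hf
    rw [h3] at h4
    have := nonneg_of_mul_nonneg_left h4 h5
    linarith

lemma rel_bound {V : Type} [Fintype V] [Nontrivial V] (G : SimpleGraph V) (hG : G.Connected) :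
    0 < (relTime (lazyP G) : ℝ) ∧ 1 ≤ (relTime (lazyP G) : ℝ) * (1 - secondEig (lazyP G)) := by
  have h := secondEig_lt G hG
  have h1 : 0 < 1 - secondEig (lazyP G) := by linarith
  have h2 : 1 / (1 - secondEig (lazyP G)) ≤ (relTime (lazyP G) : ℝ) := Nat.le_ceil _
  refine ⟨lt_of_lt_of_le (by positivity) h2, ?_⟩
  rwa [div_le_iff₀ h1] at h2

lemma gap {V : Type} [Fintype V] [Nontrivial V] (G : SimpleGraph V) (hG : G.Connected)
    (f : V → ℝ) (hf : ∑ u, (G.degree u : ℝ) * f u = 0) :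
    nrm G f ≤ relTime (lazyP G) * dirE G f := by
  set P := lazyP G with hP
  set s : V → ℝ := fun u => Real.sqrt (G.degree u) with hs
  have hs0 : ∀ u, 0 < s u := fun u => Real.sqrt_pos.2 (deg_pos' G hG u)
  have hss : ∀ u, s u * s u = G.degree u := fun u => Real.mul_self_sqrt (by positivity)
  set A : Matrix V V ℝ := fun u v => s u * P u v / s v with hA
  have hAs : ∀ u v, A u v = A v u := by
    intro u v
    simp only [hA]
    have h1 := hs0 u
    have h2 := hs0 v
    rw [div_eq_div_iff h2.ne' h1.ne']
    have := degP_symm G hG u v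
    rw [← hss, ← hss] at this
    linarith
  have hH : A.IsHermitian := by
    ext u v
    simp [Matrix.conjTranspose_apply, hAs u v]
  set e : V → V → ℝ := fun i u => hH.eigenvectorBasis i u with he
  set μ := hH.eigenvalues with hμ
  have heig : ∀ i u, ∑ v, A u v * e i v = μ i * e i u := by
    intro i u
    have := congrFun (hH.mulVec_eigenvectorBasis i) u
    simpa [Matrix.mulVec, dotProduct] using this
  set F : V → ℝ := fun u => s u * f u with hF
  set c : V → ℝ := fun i => ∑ u, e i u * F u with hc
  have hpars : ∀ H : V → ℝ, ∑ i, c i * ∑ u, e i u * H u = ∑ u, F u * H u := by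
    intro H
    have := hH.eigenvectorBasis.sum_inner_mul_inner (WithLp.toLp 2 F) (WithLp.toLp 2 H)
    simp only [PiLp.inner_apply, RCLike.inner_apply, conj_trivial] at this
    rw [show ∑ u, F u * H u = ∑ u, H u * F u from Finset.sum_congr rfl fun _ _ => mul_comm _ _,
      ← this]
    refine Finset.sum_congr rfl fun i _ => ?_
    congr 1
    exact Finset.sum_congr rfl fun _ _ => mul_comm _ _
  have hnrm : ∑ i, c i * c i = nrm G f := by
    rw [hpars F]
    unfold nrm
    refine Finset.sum_congr rfl fun u _ => ?_
    rw [← hss]; simp only [hF]; ring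
  have hPf : ∑ i, μ i * (c i * c i) = ∑ u, (G.degree u : ℝ) * f u * P.mulVec f u := by
    have h1 := hpars (fun u => ∑ v, A u v * F v)
    have h2 : ∀ i, ∑ u, e i u * ∑ v, A u v * F v = μ i * c i := by
      intro i
      simp_rw [Finset.mul_sum]
      rw [Finset.sum_comm, hc]
      simp only
      rw [Finset.mul_sum]
      refine Finset.sum_congr rfl fun v _ => ?_
      rw [← mul_assoc, ← heig i v, Finset.sum_mul]
      refine Finset.sum_congr rfl fun u _ => ?_
      rw [hAs]; ring
    simp_rw [h2] at h1
    rw [show ∑ i, μ i * (c i * c i) = ∑ i, c i * (μ i * c i) from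
      Finset.sum_congr rfl fun _ _ => by ring, h1]
    refine Finset.sum_congr rfl fun u _ => ?_
    simp only [Matrix.mulVec, dotProduct]
    rw [← hss, Finset.mul_sum, Finset.mul_sum]
    refine Finset.sum_congr rfl fun v _ => ?_
    have := (hs0 v).ne'
    simp only [hA, hF]
    field_simp
  have hmain : ∀ i, μ i * (c i * c i) ≤ secondEig P * (c i * c i) := by
    intro i
    set φ : V → ℝ := fun u => e i u / s u with hφ
    have hPφ : P.mulVec φ = μ i • φ := by
      ext u
      have h1 := heig i u
      have := (hs0 u).ne'
      simp only [Matrix.mulVec, dotProduct, Pi.smul_apply, smul_eq_mul, hφ]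
      rw [← mul_div_assoc, ← h1, Finset.sum_div]
      refine Finset.sum_congr rfl fun v _ => ?_
      have := (hs0 v).ne'
      simp only [hA]
      field_simp
    by_cases h1 : μ i = 1
    · have h2 := eig_dir G hG φ _ hPφ
      rw [h1, sub_self, zero_mul] at h2
      have h3 := dirE_zero G hG φ h2
      have : c i = 0 := by
        obtain ⟨z⟩ : Nonempty V := inferInstance
        have : c i = φ z * ∑ u, (G.degree u : ℝ) * f u := by
          simp only [hc]
          rw [Finset.mul_sum]
          refine Finset.sum_congr rfl fun u _ => ?_
          rw [h3 z u, ← hss]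
          have := (hs0 u).ne'
          simp only [hφ, hF]
          field_simp
        rw [this, hf, mul_zero]
      rw [this]; simp
    · refine mul_le_mul_of_nonneg_right ?_ (mul_self_nonneg _)
      refine le_csSup (eigset_finite G).bddAbove ⟨h1, φ, ?_, hPφ⟩
      intro h0
      have : hH.eigenvectorBasis i = 0 := by
        ext u
        have h4 := congrFun h0 u
        simp only [hφ, Pi.zero_apply, div_eq_zero_iff, (hs0 u).ne', or_false] at h4
        simpa using h4
      exact (hH.eigenvectorBasis.orthonormal.ne_zero i) this
  have hsum := Finset.sum_le_sum fun i (_ : i ∈ Finset.univ) => hmain i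
  rw [← Finset.mul_sum, hnrm, hPf] at hsum
  have hd := dirichlet G hG f
  simp_rw [mul_sub] at hd
  rw [Finset.sum_sub_distrib] at hd
  have : ∑ u, (G.degree u : ℝ) * f u * f u = nrm G f := by
    unfold nrm; exact Finset.sum_congr rfl fun _ _ => by ring
  rw [this] at hd
  have h1 : (1 - secondEig P) * nrm G f ≤ dirE G f := by linarith
  obtain ⟨hT, hT1⟩ := rel_bound G hG
  have hN := nrm_nonneg G f
  calc nrm G f ≤ (relTime P * (1 - secondEig P)) * nrm G f := le_mul_of_one_le_left hN hT1
    _ = relTime P * ((1 - secondEig P) * nrm G f) := by ring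
    _ ≤ _ := mul_le_mul_of_nonneg_left h1 hT.le

lemma pow_nonneg' {V : Type} [Fintype V] (G : SimpleGraph V) (i : ℕ) (u v : V) :
    0 ≤ (lazyP G ^ i) u v := by
  induction i generalizing u v with
  | zero => rw [pow_zero, Matrix.one_apply]; split_ifs <;> norm_num
  | succ i ih =>
    rw [pow_succ, Matrix.mul_apply]
    exact Finset.sum_nonneg fun w _ => mul_nonneg (ih _ _) (lazyP_nonneg G _ _)

lemma pow_row {V : Type} [Fintype V] [Nontrivial V] (G : SimpleGraph V) (hG : G.Connected)
    (i : ℕ) (u : V) : ∑ v, (lazyP G ^ i) u v = 1 := by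
  induction i generalizing u with
  | zero => simp [Matrix.one_apply]
  | succ i ih =>
    simp_rw [pow_succ, Matrix.mul_apply]
    rw [Finset.sum_comm]
    simp_rw [← Finset.mul_sum, lazyP_row G hG, mul_one]
    exact ih u

lemma pow_symm {V : Type} [Fintype V] [Nontrivial V] (G : SimpleGraph V) (hG : G.Connected)
    (i : ℕ) (u v : V) :
    (G.degree u : ℝ) * (lazyP G ^ i) u v = (G.degree v : ℝ) * (lazyP G ^ i) v u := by
  induction i generalizing u v with
  | zero =>
    rw [pow_zero, Matrix.one_apply, Matrix.one_apply]
    by_cases h : u = v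
    · subst h; simp
    · simp [h, Ne.symm h]
  | succ i ih =>
    conv_lhs => rw [pow_succ, Matrix.mul_apply]
    conv_rhs => rw [pow_succ', Matrix.mul_apply]
    rw [Finset.mul_sum, Finset.mul_sum]
    refine Finset.sum_congr rfl fun w _ => ?_
    calc (G.degree u : ℝ) * ((lazyP G ^ i) u w * lazyP G w v)
        = ((G.degree u : ℝ) * (lazyP G ^ i) u w) * lazyP G w v := by ring
      _ = ((G.degree w : ℝ) * lazyP G w v) * (lazyP G ^ i) w u := by rw [ih u w]; ring
      _ = _ := by rw [degP_symm G hG w v]; ring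

lemma green_nonneg {V : Type} [Fintype V] (G : SimpleGraph V) (t : ℕ) (u v : V) :
    0 ≤ green (lazyP G) t u v :=
  Finset.sum_nonneg fun i _ => pow_nonneg' G i u v

lemma green_row {V : Type} [Fintype V] [Nontrivial V] (G : SimpleGraph V) (hG : G.Connected)
    (t : ℕ) (u : V) : ∑ v, green (lazyP G) t u v = t := by
  unfold green
  rw [Finset.sum_comm]
  simp [pow_row G hG]

lemma green_symm {V : Type} [Fintype V] [Nontrivial V] (G : SimpleGraph V) (hG : G.Connected)
    (t : ℕ) (u v : V) :
    (G.degree u : ℝ) * green (lazyP G) t u v = (G.degree v : ℝ) * green (lazyP G) t v u := by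
  unfold green
  rw [Finset.mul_sum, Finset.mul_sum]
  exact Finset.sum_congr rfl fun i _ => pow_symm G hG i u v

lemma green_succ {V : Type} [Fintype V] (P : Matrix V V ℝ) (t : ℕ) (x u : V) :
    green P (t + 1) x u = (if x = u then 1 else 0) + ∑ y, P x y * green P t y u := by
  unfold green
  have h : ∑ i ∈ Finset.range t, (P ^ (i + 1)) x u =
      ∑ y, P x y * ∑ i ∈ Finset.range t, (P ^ i) y u := by
    simp_rw [Finset.mul_sum]
    rw [Finset.sum_comm]
    refine Finset.sum_congr rfl fun i _ => ?_
    rw [pow_succ', Matrix.mul_apply]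
  rw [Finset.sum_range_succ', h, pow_zero, Matrix.one_apply, add_comm]

lemma green_mono {V : Type} [Fintype V] (G : SimpleGraph V) (t : ℕ) (u v : V) :
    green (lazyP G) t u v ≤ green (lazyP G) (t + 1) u v := by
  unfold green
  rw [Finset.sum_range_succ]
  linarith [pow_nonneg' G t u v]

noncomputable def hh {V : Type} [Fintype V] (G : SimpleGraph V) (t : ℕ) (x v : V) : ℝ :=
  green (lazyP G) t x v / G.degree v - t / (2 * numEdges G)

lemma sum_deg {V : Type} [Fintype V] (G : SimpleGraph V) :
    ∑ v, (G.degree v : ℝ) = 2 * numEdges G := by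
  have := G.sum_degrees_eq_twice_card_edges
  unfold numEdges
  exact_mod_cast this

lemma edges_pos {V : Type} [Fintype V] [Nontrivial V] (G : SimpleGraph V) (hG : G.Connected) :
    0 < (numEdges G : ℝ) := by
  have h := sum_deg G
  have : 0 < ∑ v, (G.degree v : ℝ) :=
    Finset.sum_pos (fun v _ => deg_pos' G hG v) Finset.univ_nonempty
  linarith

lemma hh_mean {V : Type} [Fintype V] [Nontrivial V] (G : SimpleGraph V) (hG : G.Connected)
    (t : ℕ) (x : V) : ∑ v, (G.degree v : ℝ) * hh G t x v = 0 := by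
  have hm := edges_pos G hG
  have : ∀ v, (G.degree v : ℝ) * hh G t x v =
      green (lazyP G) t x v - G.degree v * (t / (2 * numEdges G)) := by
    intro v
    have := (deg_pos' G hG v).ne'
    unfold hh
    field_simp
  simp_rw [this]
  rw [Finset.sum_sub_distrib, green_row G hG, ← Finset.sum_mul, sum_deg]
  field_simp
  ring

lemma hh_prod {V : Type} [Fintype V] [Nontrivial V] (G : SimpleGraph V) (hG : G.Connected)
    (t : ℕ) (x y : V) :
    ∑ v, green (lazyP G) t x v * green (lazyP G) t y v / G.degree v =
      ∑ v, (G.degree v : ℝ) * (hh G t x v * hh G t y v) + (t : ℝ) ^ 2 / (2 * numEdges G) := by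
  have hm := edges_pos G hG
  have : ∀ v, green (lazyP G) t x v * green (lazyP G) t y v / G.degree v =
      (G.degree v : ℝ) * (hh G t x v * hh G t y v) +
      (t / (2 * numEdges G)) * ((G.degree v : ℝ) * hh G t x v) +
      (t / (2 * numEdges G)) * ((G.degree v : ℝ) * hh G t y v) +
      (G.degree v : ℝ) * (t / (2 * numEdges G)) ^ 2 := by
    intro v
    have := (deg_pos' G hG v).ne'
    unfold hh
    field_simp
    ring
  simp_rw [this]
  rw [Finset.sum_add_distrib, Finset.sum_add_distrib, Finset.sum_add_distrib, ← Finset.mul_sum,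
    ← Finset.mul_sum, hh_mean G hG, hh_mean G hG, ← Finset.sum_mul, sum_deg]
  field_simp
  ring

lemma hh_dir {V : Type} [Fintype V] [Nontrivial V] (G : SimpleGraph V) (hG : G.Connected)
    (t : ℕ) (x : V) :
    dirE G (hh G t x) = hh G t x x - ∑ v, (lazyP G ^ t) x v * hh G t x v := by
  have halt : ∀ v, hh G t x v = green (lazyP G) t v x / G.degree x - t / (2 * numEdges G) := by
    intro v
    unfold hh
    congr 1
    rw [div_eq_div_iff (deg_pos' G hG v).ne' (deg_pos' G hG x).ne']
    linarith [green_symm G hG t x v]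
  have hPh : ∀ v, hh G t x v - (lazyP G).mulVec (hh G t x) v =
      ((if v = x then 1 else 0) - (lazyP G ^ t) v x) / G.degree x := by
    intro v
    have h1 : (lazyP G).mulVec (hh G t x) v =
        (∑ y, lazyP G v y * green (lazyP G) t y x) / G.degree x - t / (2 * numEdges G) := by
      simp only [Matrix.mulVec, dotProduct]
      simp_rw [halt, mul_sub]
      rw [Finset.sum_sub_distrib, ← Finset.sum_mul, lazyP_row G hG, one_mul, Finset.sum_div]
      congr 1
      exact Finset.sum_congr rfl fun _ _ => by ring
    have h2 := green_succ (lazyP G) t v x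
    have h3 : green (lazyP G) (t + 1) v x = green (lazyP G) t v x + (lazyP G ^ t) v x := by
      unfold green; rw [Finset.sum_range_succ]
    have h4 : ∑ y, lazyP G v y * green (lazyP G) t y x =
      green (lazyP G) t v x + (lazyP G ^ t) v x - (if v = x then 1 else 0) := by linarith
    rw [h1, halt, h4]
    ring
  rw [← dirichlet G hG]
  have hx := (deg_pos' G hG x).ne'
  have : ∀ v, (G.degree v : ℝ) * hh G t x v * (hh G t x v - (lazyP G).mulVec (hh G t x) v) =
      (if v = x then hh G t x v else 0) - (lazyP G ^ t) x v * hh G t x v := by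
    intro v
    rw [hPh]
    have h5 := pow_symm G hG t v x
    have h6 : (lazyP G ^ t) x v = G.degree v * (lazyP G ^ t) v x / G.degree x := by
      rw [h5]; field_simp
    rw [h6]
    by_cases h : v = x
    · subst h; simp; field_simp
    · simp [h]; ring
  simp_rw [this]
  rw [Finset.sum_sub_distrib]
  simp

lemma hh_nrm {V : Type} [Fintype V] [Nontrivial V] (G : SimpleGraph V) (hG : G.Connected)
    (t : ℕ) (x : V) :
    (G.minDegree : ℝ) ^ 2 * (nrm G (hh G t x)) ^ 2 ≤ 6144 * (relTime (lazyP G) : ℝ) ^ 3 := by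
  set h := hh G t x with hh'
  set E := dirE G h with hE
  set N := nrm G h with hN
  set T : ℝ := (relTime (lazyP G) : ℝ) with hT
  set D : ℝ := (G.minDegree : ℝ) ^ 2 with hD
  have hmean := hh_mean G hG t x
  rw [← hh'] at hmean
  obtain ⟨v0, -, hv0⟩ := Finset.exists_min_image Finset.univ h Finset.univ_nonempty
  have hv0' : ∀ v, h v0 ≤ h v := fun v => hv0 v (Finset.mem_univ _)
  have h0 : h v0 ≤ 0 := by
    by_contra hc
    push Not at hc
    have : 0 < ∑ v, (G.degree v : ℝ) * h v :=
      Finset.sum_pos (fun v _ => mul_pos (deg_pos' G hG v) (hc.trans_le (hv0' v))) Finset.univ_nonempty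
    linarith
  have h1 : ∃ w, 0 ≤ h w := by
    by_contra hc
    push Not at hc
    have : ∑ v, (G.degree v : ℝ) * h v < 0 :=
      Finset.sum_neg (fun v _ => mul_neg_of_pos_of_neg (deg_pos' G hG v) (hc v)) Finset.univ_nonempty
    linarith
  obtain ⟨w, hw⟩ := h1
  have hE0 : 0 ≤ E := dirE_nonneg G h
  have hN0 : 0 ≤ N := nrm_nonneg G h
  have hT0 : 0 < T := (rel_bound G hG).1
  have hD0 : 0 ≤ D := by positivity
  have hgap : N ≤ T * E := gap G hG h hmean
  have hEN := mul_nonneg hE0 hN0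
  have ha : D * (max (h x) 0) ^ 4 ≤ 384 * E * N := by
    rcases le_or_gt (h x) 0 with hx | hx
    · rw [max_eq_right hx]; nlinarith
    · rw [max_eq_left hx.le]; exact nash G hG h x v0 h0 hx
  have hb : D * (- h v0) ^ 4 ≤ 384 * E * N := by
    rcases eq_or_lt_of_le h0 with hx | hx
    · rw [hx]; nlinarith
    · have := nash G hG (fun v => - h v) v0 w (by simpa using hw) (by simpa using hx)
      rwa [dirE_neg, nrm_neg] at this
  have hEle : E ≤ max (h x) 0 + (- h v0) := by
    have h2 := hh_dir G hG t x
    rw [← hh', ← hE] at h2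
    have h3 : h v0 ≤ ∑ v, (lazyP G ^ t) x v * h v := by
      calc h v0 = ∑ v, (lazyP G ^ t) x v * h v0 := by
            rw [← Finset.sum_mul, pow_row G hG, one_mul]
        _ ≤ _ := Finset.sum_le_sum fun v _ =>
            mul_le_mul_of_nonneg_left (hv0' v) (pow_nonneg' G t x v)
    have := le_max_left (h x) 0
    linarith
  set a := max (h x) 0
  set b := - h v0
  have ha0 : 0 ≤ a := le_max_right _ _
  have hb0 : 0 ≤ b := by simp only [b]; linarith
  have hE4 : E ^ 4 ≤ 8 * (a ^ 4 + b ^ 4) := by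
    have e1 : E ^ 4 ≤ (a + b) ^ 4 := pow_le_pow_left₀ hE0 hEle 4
    have e2 : (a + b) ^ 2 ≤ 2 * (a ^ 2 + b ^ 2) := by nlinarith [sq_nonneg (a - b)]
    have e3 : ((a + b) ^ 2) ^ 2 ≤ (2 * (a ^ 2 + b ^ 2)) ^ 2 := pow_le_pow_left₀ (by positivity) e2 2
    nlinarith [sq_nonneg (a ^ 2 - b ^ 2)]
  have hE5 : D * E ^ 4 ≤ 6144 * T * E ^ 2 := by
    have e1 := mul_le_mul_of_nonneg_left hE4 hD0
    have e2 := mul_le_mul_of_nonneg_left hgap hE0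
    nlinarith
  have hE6 : D * E ^ 2 ≤ 6144 * T := by
    rcases eq_or_lt_of_le hE0 with e | e
    · rw [← e]; nlinarith
    · have : (D * E ^ 2) * E ^ 2 ≤ (6144 * T) * E ^ 2 := by nlinarith
      exact le_of_mul_le_mul_right this (by positivity)
  have hN2 : N ^ 2 ≤ (T * E) ^ 2 := pow_le_pow_left₀ hN0 hgap 2
  calc D * N ^ 2 ≤ D * (T * E) ^ 2 := mul_le_mul_of_nonneg_left hN2 hD0
    _ = T ^ 2 * (D * E ^ 2) := by ring
    _ ≤ T ^ 2 * (6144 * T) := mul_le_mul_of_nonneg_left hE6 (by positivity)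
    _ = _ := by ring

lemma traj_cons_zero {V : Type} [Nonempty V] {t : ℕ} (a : V) (p : Fin t → V) :
    traj (Fin.cons a p : Fin (t + 1) → V) 0 = a := by
  unfold traj
  rw [dif_pos (Nat.succ_pos t)]
  rfl

lemma traj_cons_succ {V : Type} [Nonempty V] {t : ℕ} (a : V) (p : Fin t → V) (i : ℕ) :
    traj (Fin.cons a p : Fin (t + 1) → V) (i + 1) = traj p i := by
  unfold traj
  by_cases h : i < t
  · rw [dif_pos h, dif_pos (by omega)]
    rfl
  · rw [dif_neg h, dif_neg (by omega)]

lemma path_one {V : Type} [Fintype V] [Nonempty V] (P : Matrix V V ℝ) (x : V)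
    (F : (Fin 1 → V) → ℝ) : ∑ p, pathWeight P x 1 p * F p = F (fun _ => x) := by
  rw [Fintype.sum_eq_single (fun _ => x)]
  · simp [pathWeight, traj]
  · intro p hp
    have : traj p 0 ≠ x := by
      intro h
      apply hp
      ext i
      rw [← h]
      simp [traj, Subsingleton.elim i 0]
    simp [pathWeight, this]

lemma path_succ {V : Type} [Fintype V] [Nonempty V] (P : Matrix V V ℝ) (x : V) (s : ℕ)
    (F : (Fin (s + 2) → V) → ℝ) :
    ∑ p, pathWeight P x (s + 2) p * F p =
      ∑ y, P x y * ∑ p : Fin (s + 1) → V, pathWeight P y (s + 1) p * F (Fin.cons x p) := by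
  rw [← (Fin.consEquiv (fun _ : Fin (s + 2) => V)).sum_comp, Fintype.sum_prod_type]
  have hw : ∀ (a : V) (p : Fin (s + 1) → V),
      pathWeight P x (s + 2) (Fin.cons a p : Fin (s + 2) → V) = (if a = x then 1 else 0) *
        ((∏ i ∈ Finset.range s, P (traj p i) (traj p (i + 1))) * P a (traj p 0)) := by
    intro a p
    unfold pathWeight
    rw [traj_cons_zero]
    congr 1
    rw [show s + 2 - 1 = s + 1 from rfl, Finset.prod_range_succ']
    simp only [traj_cons_succ, traj_cons_zero]
  have h1 : ∀ a, ∑ p : Fin (s + 1) → V,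
      pathWeight P x (s + 2) ((Fin.consEquiv (fun _ : Fin (s + 2) => V)) (a, p)) *
        F ((Fin.consEquiv (fun _ : Fin (s + 2) => V)) (a, p)) =
      if a = x then ∑ p : Fin (s + 1) → V,
        ((∏ i ∈ Finset.range s, P (traj p i) (traj p (i + 1))) * P x (traj p 0)) *
          F (Fin.cons x p) else 0 := by
    intro a
    have hc : ∀ p : Fin (s + 1) → V, (Fin.consEquiv (fun _ : Fin (s + 2) => V)) (a, p) =
        (Fin.cons a p : Fin (s + 2) → V) := fun _ => rfl
    simp_rw [hc, hw]
    by_cases h : a = x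
    · subst h; simp
    · simp [h]
  simp_rw [h1]
  rw [Finset.sum_ite_eq' Finset.univ x, if_pos (Finset.mem_univ _)]
  simp_rw [Finset.mul_sum]
  rw [Finset.sum_comm]
  refine Finset.sum_congr rfl fun p _ => ?_
  simp only [pathWeight]
  rw [Finset.sum_eq_single (traj p 0)]
  · simp; ring
  · intro b _ hb
    simp [Ne.symm hb]
  · simp

lemma pathWeight_nonneg {V : Type} [Fintype V] [Nonempty V] (G : SimpleGraph V) (x : V) (t : ℕ)
    (p : Fin t → V) : 0 ≤ pathWeight (lazyP G) x t p := by
  unfold pathWeight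
  refine mul_nonneg ?_ (Finset.prod_nonneg fun _ _ => lazyP_nonneg G _ _)
  split_ifs <;> norm_num

noncomputable def occ {V : Type} [Nonempty V] {t : ℕ} (p : Fin t → V) (u : V) : ℝ :=
  ∑ i ∈ Finset.range t, if traj p i = u then 1 else 0

lemma occ_cons {V : Type} [Nonempty V] {t : ℕ} (a : V) (p : Fin t → V) (u : V) :
    occ (Fin.cons a p : Fin (t + 1) → V) u = (if a = u then 1 else 0) + occ p u := by
  unfold occ
  rw [Finset.sum_range_succ', traj_cons_zero, add_comm]
  simp only [traj_cons_succ]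

lemma occ_one {V : Type} [Nonempty V] (x u : V) :
    occ (fun _ : Fin 1 => x) u = if x = u then 1 else 0 := by
  unfold occ
  rw [Finset.sum_range_one]
  simp [traj]

lemma path_mass {V : Type} [Fintype V] [Nontrivial V] (G : SimpleGraph V) (hG : G.Connected)
    (s : ℕ) (x : V) : ∑ p, pathWeight (lazyP G) x (s + 1) p = 1 := by
  induction s generalizing x with
  | zero => simpa using path_one (lazyP G) x (fun _ => 1)
  | succ s ih =>
    have := path_succ (lazyP G) x s (fun _ => 1)
    simp only [mul_one] at this
    rw [this]
    simp_rw [ih, mul_one]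
    exact lazyP_row G hG x

lemma path_occ {V : Type} [Fintype V] [Nontrivial V] (G : SimpleGraph V) (hG : G.Connected)
    (s : ℕ) (x u : V) :
    ∑ p, pathWeight (lazyP G) x (s + 1) p * occ p u = green (lazyP G) (s + 1) x u := by
  induction s generalizing x with
  | zero =>
    rw [path_one, occ_one]
    simp [green, Matrix.one_apply]
  | succ s ih =>
    rw [path_succ, green_succ]
    simp_rw [occ_cons, mul_add, Finset.sum_add_distrib, ih, ← Finset.sum_mul, path_mass G hG,
      one_mul, mul_add, Finset.sum_add_distrib, ← Finset.sum_mul, lazyP_row G hG, one_mul]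

lemma path_occ2 {V : Type} [Fintype V] [Nontrivial V] (G : SimpleGraph V) (hG : G.Connected)
    (s : ℕ) (x u v : V) :
    ∑ p, pathWeight (lazyP G) x (s + 1) p * (occ p u * occ p v) ≤
      green (lazyP G) (s + 1) x u * green (lazyP G) (s + 1) u v +
      green (lazyP G) (s + 1) x v * green (lazyP G) (s + 1) v u := by
  induction s generalizing x with
  | zero =>
    rw [path_one, occ_one, occ_one]
    simp only [green, zero_add, Finset.range_one, Finset.sum_singleton, pow_zero, Matrix.one_apply]
    by_cases h1 : x = u <;> by_cases h2 : x = v <;> by_cases h3 : u = v <;> simp_all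
  | succ s ih =>
    rw [path_succ]
    set g := green (lazyP G) (s + 1) with hg
    set g' := green (lazyP G) (s + 2) with hg'
    set δ : V → ℝ := fun w => if x = w then 1 else 0 with hδ
    have h1 : ∀ y, ∑ p : Fin (s + 1) → V, pathWeight (lazyP G) y (s + 1) p *
        (occ (Fin.cons x p : Fin (s + 2) → V) u * occ (Fin.cons x p : Fin (s + 2) → V) v) ≤
        δ u * δ v + δ u * g y v + δ v * g y u + (g y u * g u v + g y v * g v u) := by
      intro y
      refine le_trans (le_of_eq ?_) (add_le_add_right (ih y) _)
      rw [hg, ← path_occ G hG s y u, ← path_occ G hG s y v, Finset.mul_sum, Finset.mul_sum,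
        ← one_mul (δ u * δ v), ← path_mass G hG s y, Finset.sum_mul, ← Finset.sum_add_distrib,
        ← Finset.sum_add_distrib, ← Finset.sum_add_distrib]
      refine Finset.sum_congr rfl fun p _ => ?_
      rw [occ_cons, occ_cons]
      simp only [hδ]
      ring
    set Pu := ∑ y, lazyP G x y * g y u with hPu
    set Pv := ∑ y, lazyP G x y * g y v with hPv
    have h2 : ∑ y, lazyP G x y * ∑ p : Fin (s + 1) → V, pathWeight (lazyP G) y (s + 1) p *
        (occ (Fin.cons x p : Fin (s + 2) → V) u * occ (Fin.cons x p : Fin (s + 2) → V) v) ≤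
        δ u * δ v + δ u * Pv + δ v * Pu + (Pu * g u v + Pv * g v u) := by
      refine (Finset.sum_le_sum fun y _ =>
        mul_le_mul_of_nonneg_left (h1 y) (lazyP_nonneg G x y)).trans (le_of_eq ?_)
      have h0 : δ u * δ v = ∑ y, lazyP G x y * (δ u * δ v) := by
        rw [← Finset.sum_mul, lazyP_row G hG x, one_mul]
      rw [hPu, hPv, Finset.mul_sum, Finset.mul_sum, Finset.sum_mul, Finset.sum_mul]
      conv_rhs => rw [h0]
      rw [← Finset.sum_add_distrib,
        ← Finset.sum_add_distrib, ← Finset.sum_add_distrib, ← Finset.sum_add_distrib]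
      refine Finset.sum_congr rfl fun y _ => ?_
      ring
    refine h2.trans ?_
    have hPu0 : 0 ≤ Pu := Finset.sum_nonneg fun y _ =>
      mul_nonneg (lazyP_nonneg G _ _) (green_nonneg G _ _ _)
    have hPv0 : 0 ≤ Pv := Finset.sum_nonneg fun y _ =>
      mul_nonneg (lazyP_nonneg G _ _) (green_nonneg G _ _ _)
    have e1 : g' x u = δ u + Pu := green_succ _ _ _ _
    have e2 : g' x v = δ v + Pv := green_succ _ _ _ _
    have m1 : g u v ≤ g' u v := green_mono G _ _ _
    have m2 : g v u ≤ g' v u := green_mono G _ _ _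
    have k1 : δ u * (δ v + Pv) = δ u * g' u v := by
      by_cases h : x = u
      · subst h; rw [← e2]
      · simp [hδ, h]
    have k2 : δ v * Pu ≤ δ v * g' v u := by
      by_cases h : x = v
      · subst h
        have : 0 ≤ δ u := by simp only [hδ]; split_ifs <;> norm_num
        have h1 : δ x = 1 := by simp [hδ]
        rw [e1, h1]; linarith
      · simp [hδ, h]
    rw [e1, e2]
    have := mul_le_mul_of_nonneg_left m1 hPu0
    have := mul_le_mul_of_nonneg_left m2 hPv0
    nlinarith

lemma wInter_eq {V : Type} [Fintype V] [Nonempty V] (G : SimpleGraph V) {t : ℕ} (p q : Fin t → V) :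
    wInter G p q = ∑ u, occ p u * occ q u / G.degree u := by
  unfold wInter wInterIco occ
  rw [← Finset.range_eq_Ico]
  have : ∀ u, (∑ i ∈ Finset.range t, if traj p i = u then (1 : ℝ) else 0) *
      (∑ j ∈ Finset.range t, if traj q j = u then (1 : ℝ) else 0) / G.degree u =
      ∑ i ∈ Finset.range t, ∑ j ∈ Finset.range t,
        if traj p i = u then (if traj q j = u then 1 / (G.degree u : ℝ) else 0) else 0 := by
    intro u
    rw [Finset.sum_mul_sum, Finset.sum_div]
    refine Finset.sum_congr rfl fun i _ => ?_
    rw [Finset.sum_div]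
    refine Finset.sum_congr rfl fun j _ => ?_
    split_ifs <;> simp
  simp_rw [this]
  rw [Finset.sum_comm (s := (Finset.univ : Finset V))]
  refine Finset.sum_congr rfl fun i _ => ?_
  rw [Finset.sum_comm (s := (Finset.univ : Finset V))]
  refine Finset.sum_congr rfl fun j _ => ?_
  rw [Finset.sum_ite_eq, if_pos (Finset.mem_univ _)]
  simp only [eq_comm]

lemma E2_prod {V : Type} [Fintype V] [Nonempty V] (P : Matrix V V ℝ) (x y : V) (t : ℕ)
    {ι : Type} [Fintype ι] (a b : ι → (Fin t → V) → ℝ) (c : ι → ℝ) :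
    E2 P x y t (fun p q => ∑ i, a i p * b i q * c i) =
      ∑ i, (∑ p, pathWeight P x t p * a i p) * (∑ q, pathWeight P y t q * b i q) * c i := by
  unfold E2
  simp_rw [Finset.sum_mul_sum, Finset.sum_mul, Finset.mul_sum]
  rw [Finset.sum_comm (s := (Finset.univ : Finset ι))]
  refine Finset.sum_congr rfl fun p _ => ?_
  rw [Finset.sum_comm]
  refine Finset.sum_congr rfl fun i _ => Finset.sum_congr rfl fun q _ => ?_
  ring

lemma EI_eq {V : Type} [Fintype V] [Nontrivial V] (G : SimpleGraph V) (hG : G.Connected)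
    (s : ℕ) (x y : V) :
    E2 (lazyP G) x y (s + 1) (fun p q => wInter G p q) =
      ∑ u, green (lazyP G) (s + 1) x u * green (lazyP G) (s + 1) y u / G.degree u := by
  simp_rw [wInter_eq, div_eq_mul_inv]
  rw [E2_prod (lazyP G) x y (s + 1) (fun u p => occ p u) (fun u p => occ p u)]
  simp_rw [path_occ G hG]

lemma EI2_le {V : Type} [Fintype V] [Nontrivial V] (G : SimpleGraph V) (hG : G.Connected)
    (s : ℕ) (x y : V) (M : ℝ)
    (hM : ∀ u, ∑ v, green (lazyP G) (s + 1) u v * green (lazyP G) (s + 1) u v / G.degree v ≤ M) :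
    E2 (lazyP G) x y (s + 1) (fun p q => (wInter G p q) ^ 2) ≤ 4 * M ^ 2 := by
  set g := green (lazyP G) (s + 1) with hg
  have hg0 : ∀ u v, 0 ≤ g u v := fun u v => green_nonneg G _ _ _
  have hM0 : 0 ≤ M := (Finset.sum_nonneg fun v _ =>
    div_nonneg (mul_nonneg (hg0 x v) (hg0 x v)) (by positivity)).trans (hM x)
  have h1 : ∀ p q : Fin (s + 1) → V, (wInter G p q) ^ 2 = ∑ z : V × V,
      (occ p z.1 * occ p z.2) * (occ q z.1 * occ q z.2) *
        ((G.degree z.1 : ℝ)⁻¹ * (G.degree z.2 : ℝ)⁻¹) := by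
    intro p q
    rw [wInter_eq, sq, Finset.sum_mul_sum, Fintype.sum_prod_type]
    refine Finset.sum_congr rfl fun u _ => Finset.sum_congr rfl fun v _ => ?_
    rw [div_eq_mul_inv, div_eq_mul_inv]; ring
  simp_rw [h1]
  rw [E2_prod (lazyP G) x y (s + 1) (fun (z : V × V) p => occ p z.1 * occ p z.2)
    (fun z p => occ p z.1 * occ p z.2) (fun z => (G.degree z.1 : ℝ)⁻¹ * (G.degree z.2 : ℝ)⁻¹)]
  set D : V → V → ℝ := fun u v => (G.degree u : ℝ)⁻¹ * (G.degree v : ℝ)⁻¹ with hD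
  have hA : ∀ w, ∑ u, ∑ v, (g w u * g u v) ^ 2 * D u v ≤ M ^ 2 := by
    intro w
    calc ∑ u, ∑ v, (g w u * g u v) ^ 2 * D u v
        = ∑ u, (g w u * g w u / G.degree u) * ∑ v, g u v * g u v / G.degree v := by
          refine Finset.sum_congr rfl fun u _ => ?_
          rw [Finset.mul_sum]
          refine Finset.sum_congr rfl fun v _ => ?_
          simp only [hD, div_eq_mul_inv]; ring
      _ ≤ ∑ u, (g w u * g w u / G.degree u) * M := Finset.sum_le_sum fun u _ =>
          mul_le_mul_of_nonneg_left (hM u) (div_nonneg (mul_nonneg (hg0 _ _) (hg0 _ _)) (by positivity))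
      _ ≤ M * M := by
          rw [← Finset.sum_mul]
          exact mul_le_mul_of_nonneg_right (hM w) hM0
      _ = _ := by ring
  have hB : ∀ w, ∑ u, ∑ v, (g w v * g v u) ^ 2 * D u v ≤ M ^ 2 := by
    intro w
    rw [Finset.sum_comm]
    refine le_trans (le_of_eq ?_) (hA w)
    refine Finset.sum_congr rfl fun u _ => Finset.sum_congr rfl fun v _ => ?_
    simp only [hD]; ring
  calc _ ≤ ∑ z : V × V, (((g x z.1 * g z.1 z.2) ^ 2 * D z.1 z.2 + (g x z.2 * g z.2 z.1) ^ 2 * D z.1 z.2) +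
        ((g y z.1 * g z.1 z.2) ^ 2 * D z.1 z.2 + (g y z.2 * g z.2 z.1) ^ 2 * D z.1 z.2)) := by
        refine Finset.sum_le_sum fun z _ => ?_
        have i1 := path_occ2 G hG s x z.1 z.2
        have i2 := path_occ2 G hG s y z.1 z.2
        rw [← hg] at i1 i2
        have hocc : ∀ (p : Fin (s + 1) → V) u, 0 ≤ occ p u := fun p u =>
          Finset.sum_nonneg fun i _ => by split_ifs <;> norm_num
        have n2 : 0 ≤ ∑ p, pathWeight (lazyP G) y (s + 1) p * (occ p z.1 * occ p z.2) :=
          Finset.sum_nonneg fun p _ => mul_nonneg (pathWeight_nonneg G _ _ _)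
            (mul_nonneg (hocc _ _) (hocc _ _))
        have hDn : 0 ≤ D z.1 z.2 := by simp only [hD]; positivity
        have q1 := mul_nonneg (hg0 x z.1) (hg0 z.1 z.2)
        have q2 := mul_nonneg (hg0 x z.2) (hg0 z.2 z.1)
        have i3 := mul_le_mul i1 i2 n2 (by positivity)
        refine (mul_le_mul_of_nonneg_right i3 hDn).trans ?_
        rw [← add_mul, ← add_mul, ← add_mul]
        refine mul_le_mul_of_nonneg_right ?_ hDn
        generalize g x z.1 * g z.1 z.2 = a
        generalize g x z.2 * g z.2 z.1 = b
        generalize g y z.1 * g z.1 z.2 = a'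
        generalize g y z.2 * g z.2 z.1 = b'
        nlinarith [sq_nonneg (a + b - a' - b'), sq_nonneg (a - b), sq_nonneg (a' - b')]
    _ ≤ _ := by
        rw [Fintype.sum_prod_type]
        simp only [Finset.sum_add_distrib]
        linarith [hA x, hA y, hB x, hB y]

lemma paley {V : Type} [Fintype V] [Nonempty V] (G : SimpleGraph V) (t : ℕ) (x y : V) :
    (E2 (lazyP G) x y t (fun p q => wInter G p q)) ^ 2 ≤
      E2 (lazyP G) x y t (fun p q => (wInter G p q) ^ 2) *
      E2 (lazyP G) x y t (fun p q => if 0 < wInter G p q then 1 else 0) := by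
  unfold E2
  simp_rw [← Fintype.sum_prod_type']
  refine Finset.sum_sq_le_sum_mul_sum_of_sq_le_mul _ ?_ ?_ ?_
  · intro z _
    exact mul_nonneg (mul_nonneg (pathWeight_nonneg G _ _ _) (pathWeight_nonneg G _ _ _)) (sq_nonneg _)
  · intro z _
    refine mul_nonneg (mul_nonneg (pathWeight_nonneg G _ _ _) (pathWeight_nonneg G _ _ _)) ?_
    split_ifs <;> norm_num
  · intro z _
    have h0 : 0 ≤ wInter G z.1 z.2 := by
      unfold wInter wInterIco
      refine Finset.sum_nonneg fun i _ => Finset.sum_nonneg fun j _ => ?_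
      split_ifs <;> positivity
    refine le_of_eq ?_
    split_ifs with h
    · ring
    · have : wInter G z.1 z.2 = 0 := le_antisymm (not_lt.1 h) h0
      rw [this]; ring

lemma hh_small {V : Type} [Fintype V] [Nontrivial V] (G : SimpleGraph V) (hG : G.Connected)
    (t : ℕ) (u : V)
    (ht : 100 * (relTime (lazyP G) : ℝ) ^ ((3 : ℝ) / 4) *
            Real.sqrt ((numEdges G : ℝ) / (G.minDegree : ℝ)) ≤ (t : ℝ)) :
    nrm G (hh G t u) ≤ (t : ℝ) ^ 2 / (2 * numEdges G) / 8 := by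
  have hN := hh_nrm G hG t u
  have hN0 := nrm_nonneg G (hh G t u)
  have hm := edges_pos G hG
  have hT := (rel_bound G hG).1
  have hd : 0 < (G.minDegree : ℝ) := by
    obtain ⟨v, hv⟩ := G.exists_minimal_degree_vertex
    rw [hv]; exact deg_pos' G hG v
  generalize nrm G (hh G t u) = N at *
  generalize (relTime (lazyP G) : ℝ) = T at *
  generalize (G.minDegree : ℝ) = d at *
  generalize (numEdges G : ℝ) = m at *
  have h4 : (100 * T ^ ((3 : ℝ) / 4) * Real.sqrt (m / d)) ^ 4 ≤ (t : ℝ) ^ 4 :=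
    pow_le_pow_left₀ (by positivity) ht 4
  have e1 : (T ^ ((3 : ℝ) / 4)) ^ 4 = T ^ 3 := by
    rw [← Real.rpow_natCast, ← Real.rpow_mul hT.le]
    norm_num
  have e2 : (Real.sqrt (m / d)) ^ 4 = (m / d) ^ 2 := by
    rw [show 4 = 2 * 2 from rfl, pow_mul, Real.sq_sqrt (by positivity)]
  rw [mul_pow, mul_pow, e1, e2] at h4
  have e3 : T ^ 3 * (m / d) ^ 2 ≥ N ^ 2 * m ^ 2 / 6144 := by
    rw [div_pow, ge_iff_le, ← mul_div_assoc, div_le_div_iff₀ (by norm_num) (by positivity)]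
    have := mul_le_mul_of_nonneg_right hN (sq_nonneg m)
    nlinarith
  have e4 : (16 * m * N) ^ 2 ≤ ((t : ℝ) ^ 2) ^ 2 := by
    have : 0 ≤ N ^ 2 * m ^ 2 := by positivity
    nlinarith
  have e5 : 16 * m * N ≤ (t : ℝ) ^ 2 := (pow_le_pow_iff_left₀ (by positivity) (by positivity) two_ne_zero).1 e4
  rw [div_div, le_div_iff₀ (by positivity)]
  linarith

/-- There is a universal constant `c > 0` such that for every finite
connected graph `G` with `m` edges, minimum degree `d` and relaxation time `t_rel`, all
vertices `x, y` and every `t ≥ c t_rel^{3/4} √(m/d)`, two independent lazy random walks of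
length `t` started at `x` and `y` intersect with probability at least `1/8`. -/
theorem intersection_probability_bound : ∃ c : ℝ, 0 < c ∧
    ∀ (V : Type) [Fintype V] [Nontrivial V] (G : SimpleGraph V), G.Connected →
      ∀ (x y : V) (t : ℕ),
        c * (relTime (lazyP G) : ℝ) ^ ((3 : ℝ) / 4) *
            Real.sqrt ((numEdges G : ℝ) / (G.minDegree : ℝ)) ≤ (t : ℝ) →
          (1 / 8 : ℝ) ≤
            E2 (lazyP G) x y t fun p q => if 0 < wInter G p q then 1 else 0 := by
  refine ⟨100, by norm_num, ?_⟩
  intro V _ _ G hG x y t ht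
  have hm := edges_pos G hG
  have hT := (rel_bound G hG).1
  have hd : 0 < (G.minDegree : ℝ) := by
    obtain ⟨v, hv⟩ := G.exists_minimal_degree_vertex
    rw [hv]; exact deg_pos' G hG v
  have ht0 : 0 < (t : ℝ) := lt_of_lt_of_le (by positivity) ht
  have hsm := fun u => hh_small G hG t u ht
  obtain ⟨s, rfl⟩ : ∃ s, t = s + 1 := ⟨t - 1, by
    have : 0 < t := by exact_mod_cast ht0
    omega⟩
  set a : ℝ := ((s + 1 : ℕ) : ℝ) ^ 2 / (2 * numEdges G) with ha
  have ha0 : 0 < a := by positivity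
  have hM : ∀ u, ∑ v, green (lazyP G) (s + 1) u v * green (lazyP G) (s + 1) u v / G.degree v ≤
      9 / 8 * a := by
    intro u
    rw [hh_prod G hG]
    have h1 := hsm u
    unfold nrm at h1
    simp_rw [sq (hh _ _ _ _)] at h1
    rw [← ha]
    linarith
  have h2 := EI2_le G hG s x y _ hM
  have hlow : 7 / 8 * a ≤ E2 (lazyP G) x y (s + 1) (fun p q => wInter G p q) := by
    rw [EI_eq G hG, hh_prod G hG, ← ha]
    have h1 := hsm x
    have h3 := hsm y
    unfold nrm at h1 h3
    have : 0 ≤ ∑ v, (G.degree v : ℝ) * (hh G (s + 1) x v + hh G (s + 1) y v) ^ 2 :=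
      Finset.sum_nonneg fun v _ => by positivity
    have h4 : ∑ v, (G.degree v : ℝ) * (hh G (s + 1) x v + hh G (s + 1) y v) ^ 2 =
        ∑ v, (G.degree v : ℝ) * hh G (s + 1) x v ^ 2 + ∑ v, (G.degree v : ℝ) * hh G (s + 1) y v ^ 2
        + 2 * ∑ v, (G.degree v : ℝ) * (hh G (s + 1) x v * hh G (s + 1) y v) := by
      rw [Finset.mul_sum, ← Finset.sum_add_distrib, ← Finset.sum_add_distrib]
      exact Finset.sum_congr rfl fun v _ => by ring
    linarith
  have hp := paley G (s + 1) x y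
  set Q := E2 (lazyP G) x y (s + 1) fun p q => if 0 < wInter G p q then (1 : ℝ) else 0 with hQ
  have hQ0 : 0 ≤ Q := by
    rw [hQ]; unfold E2
    refine Finset.sum_nonneg fun p _ => Finset.sum_nonneg fun q _ => ?_
    refine mul_nonneg (mul_nonneg (pathWeight_nonneg G _ _ _) (pathWeight_nonneg G _ _ _)) ?_
    dsimp only
    split_ifs <;> norm_num
  have h5 := mul_le_mul_of_nonneg_right h2 hQ0
  have h6 : (7 / 8 * a) ^ 2 ≤ (E2 (lazyP G) x y (s + 1) (fun p q => wInter G p q)) ^ 2 :=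
    pow_le_pow_left₀ (by positivity) hlow 2
  have h7 : a ^ 2 * (49 / 64) ≤ a ^ 2 * (81 / 16 * Q) := by nlinarith
  have h8 := le_of_mul_le_mul_left h7 (by positivity)
  linarith
end
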